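/- arXiv:2004.07367 — 2 statements merged into one kernel-verified Lean document; each statement's English description precedes it below -/
import Mathlib

section
/- Let (X,d,φ) be a mixing semi-conformal Smale space (i.e. λ_X = min{Lip(φ), Lip(φ^{-1})}), and let ℛ₁ be a Markov partition of X with diam(R) ≤ ε''_X/2 for every R ∈ ℛ₁, giving rise to the refining sequence (ℛ_n)_{n≥0} of Markov partitions. Then there exist a constant K > 0 and a φ-invariant Borel probability measure μ on X such that for every n ≥ 1 and every R ∈ ℛ_n, K^{-1}·diam(R)^{s₀} ≤ μ(R) ≤ K·diam(R)^{s₀}, where s₀ = 2·h(φ)/log(λ_X). -/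
open Set Metric MeasureTheory Topology
open scoped ENNReal NNReal

/-- A dynamical system is irreducible if for every ordered pair of nonempty open
sets `U, V` there is `n : ℕ` with `ψ^[n] '' U ∩ V ≠ ∅`. -/
def IrreducibleSystem {Z : Type*} [TopologicalSpace Z] (ψ : Z → Z) : Prop :=
  ∀ U V : Set Z, IsOpen U → IsOpen V → U.Nonempty → V.Nonempty →
    ∃ n : ℕ, (ψ^[n] '' U ∩ V).Nonempty

/-- A dynamical system is mixing if for every ordered pair of nonempty open sets
`U, V` there is `N : ℕ` with `ψ^[n] '' U ∩ V ≠ ∅` for all `n ≥ N`. -/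
def MixingSystem {Z : Type*} [TopologicalSpace Z] (ψ : Z → Z) : Prop :=
  ∀ U V : Set Z, IsOpen U → IsOpen V → U.Nonempty → V.Nonempty →
    ∃ N : ℕ, ∀ n ≥ N, (ψ^[n] '' U ∩ V).Nonempty

/-- The (possibly infinite) Lipschitz constant of a map between metric spaces. -/
noncomputable def lipConst {X : Type*} [PseudoEMetricSpace X] (f : X → X) : ℝ≥0∞ :=
  sInf {K : ℝ≥0∞ | ∀ x y : X, edist (f x) (f y) ≤ K * edist x y}

/-- A measure on a metric space is Ahlfors `s`-regular if closed balls of radius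
`r < diam Z` have measure comparable to `r ^ s`. -/
def AhlforsRegular {Z : Type*} [MetricSpace Z] [MeasurableSpace Z]
    (μ : Measure Z) (s : ℝ) : Prop :=
  0 < s ∧ ∃ C : ℝ, 0 < C ∧ ∀ (z : Z) (r : ℝ), 0 ≤ r → r < diam (Set.univ : Set Z) →
    ENNReal.ofReal (C⁻¹ * r ^ s) ≤ μ (closedBall z r) ∧
    μ (closedBall z r) ≤ ENNReal.ofReal (C * r ^ s)

/-- A Smale space: a compact metric space together with a homeomorphism `phi`,
constants `eps > 0`, `lam > 1` and a partially defined continuous bracket map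
satisfying the bracket axioms and the contraction axioms. -/
structure SmaleSpace (X : Type*) [MetricSpace X] where
  phi : Equiv.Perm X
  phi_cont : Continuous phi
  phi_symm_cont : Continuous phi.symm
  eps : ℝ
  lam : ℝ
  eps_pos : 0 < eps
  one_lt_lam : 1 < lam
  bracket : X → X → X
  bracket_cont : ContinuousOn (fun p : X × X => bracket p.1 p.2)
    {p : X × X | dist p.1 p.2 ≤ eps}
  bracket_self : ∀ x : X, bracket x x = x
  bracket_assoc₁ : ∀ x y z : X, dist y z ≤ eps → dist x (bracket y z) ≤ eps →
    dist x z ≤ eps → bracket x (bracket y z) = bracket x z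
  bracket_assoc₂ : ∀ x y z : X, dist x y ≤ eps → dist (bracket x y) z ≤ eps →
    dist x z ≤ eps → bracket (bracket x y) z = bracket x z
  bracket_phi : ∀ x y : X, dist x y ≤ eps → dist (phi x) (phi y) ≤ eps →
    phi (bracket x y) = bracket (phi x) (phi y)
  contract_s : ∀ (x : X) (ε : ℝ), 0 < ε → ε ≤ eps → ∀ y z : X,
    dist x y < ε → bracket x y = y → dist x z < ε → bracket x z = z →
    dist (phi y) (phi z) ≤ lam⁻¹ * dist y z
  contract_u : ∀ (x : X) (ε : ℝ), 0 < ε → ε ≤ eps → ∀ y z : X,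
    dist x y < ε → bracket y x = y → dist x z < ε → bracket z x = z →
    dist (phi.symm y) (phi.symm z) ≤ lam⁻¹ * dist y z

namespace SmaleSpace

variable {X : Type*} [MetricSpace X] (S : SmaleSpace X)

/-- The local stable set `X^s(x, ε)`. -/
def stable (x : X) (ε : ℝ) : Set X := {y | dist x y < ε ∧ S.bracket x y = y}

/-- The local unstable set `X^u(x, ε)`. -/
def unstable (x : X) (ε : ℝ) : Set X := {y | dist x y < ε ∧ S.bracket y x = y}

/-- A rectangle (relative to the constant `ε'`): a nonempty set of diameter at
most `ε'` closed under the bracket. -/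
def IsRectangle (ε' : ℝ) (R : Set X) : Prop :=
  R.Nonempty ∧ diam R ≤ ε' ∧ ∀ x ∈ R, ∀ y ∈ R, S.bracket x y ∈ R

/-- A proper rectangle: a closed rectangle equal to the closure of its interior. -/
def IsProperRectangle (ε' : ℝ) (R : Set X) : Prop :=
  S.IsRectangle ε' R ∧ IsClosed R ∧ R = closure (interior R)

/-- `X^s(x, R) = X^s(x, 2ε') ∩ R`. -/
def stableIn (ε' : ℝ) (x : X) (R : Set X) : Set X := S.stable x (2 * ε') ∩ R

/-- `X^u(x, R) = X^u(x, 2ε') ∩ R`. -/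
def unstableIn (ε' : ℝ) (x : X) (R : Set X) : Set X := S.unstable x (2 * ε') ∩ R

/-- A Markov partition: a finite cover by nonempty proper rectangles with
pairwise disjoint interiors, satisfying the Markov conditions. -/
def IsMarkovPartition (ε' : ℝ) (P : Set (Set X)) : Prop :=
  P.Finite ∧ ⋃₀ P = Set.univ ∧
  (∀ R ∈ P, S.IsProperRectangle ε' R) ∧
  (∀ R ∈ P, ∀ R' ∈ P, R ≠ R' → interior R ∩ interior R' = ∅) ∧
  (∀ R ∈ P, ∀ R' ∈ P, ∀ x : X, x ∈ interior R → S.phi x ∈ interior R' →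
    S.unstableIn ε' (S.phi x) R' ⊆ S.phi '' (S.unstableIn ε' x R) ∧
    S.phi '' (S.stableIn ε' x R) ⊆ S.stableIn ε' (S.phi x) R')

/-- The refining sequence of Markov partitions
`ℛ_n = {⋂_{i=1-n}^{n-1} φ^{-i}(R_{x_i}) : R_{x_i} ∈ ℛ₁, int ≠ ∅}`, with
`ℛ₀ = {X}`. -/
def markovSeq (P : Set (Set X)) : ℕ → Set (Set X)
  | 0 => {Set.univ}
  | (n + 1) => {R | (interior R).Nonempty ∧ ∃ g : ℤ → Set X, (∀ i : ℤ, g i ∈ P) ∧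
      R = ⋂ i ∈ Finset.Icc (-(n : ℤ)) (n : ℤ), (⇑(S.phi ^ i)) ⁻¹' (g i)}

end SmaleSpace

/-- `N_𝒰(Y)`: the elements of the cover `𝒰` meeting the set `Y`. -/
def nbr {X : Type*} (U : Set (Set X)) (Y : Set X) : Set (Set X) :=
  {u ∈ U | (u ∩ Y).Nonempty}

/-- The property defining the constant `ε'_X` of a Smale space. -/
def SmaleSpace.epsOne {X : Type*} [MetricSpace X] (S : SmaleSpace X) (ε' : ℝ) : Prop :=
  0 < ε' ∧ ε' ≤ S.eps / 2 ∧ ∀ x y : X, dist x y ≤ ε' →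
    dist x (S.bracket x y) < S.eps / 2 ∧ dist y (S.bracket x y) < S.eps / 2

/-- The property defining the constant `ε''_X` of a Smale space. -/
def SmaleSpace.epsTwo {X : Type*} [MetricSpace X] (S : SmaleSpace X) (ε' ε'' : ℝ) : Prop :=
  0 < ε'' ∧ ε'' < ε' / 12 ∧ ∀ x y : X, dist x y ≤ ε'' →
    (∀ i : ℤ, |i| ≤ 2 → dist ((S.phi ^ i) x) ((S.phi ^ i) y) ≤ ε' / 2) ∧
    dist (S.bracket x y) x ≤ ε' / 4 ∧ dist (S.bracket x y) y ≤ ε' / 4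

open Set Metric Topology MeasureTheory
open scoped ENNReal

open Set Metric MeasureTheory Topology
open scoped ENNReal NNReal
namespace SB

variable {X : Type*} [MetricSpace X]

/-- iterate -/
def it (S : SmaleSpace X) (i : ℤ) (x : X) : X := (S.phi ^ i) x

section
variable (S : SmaleSpace X)

lemma it_zero (x : X) : it S 0 x = x := by simp [it]
lemma it_one (x : X) : it S 1 x = S.phi x := by simp [it]
lemma it_neg_one (x : X) : it S (-1) x = S.phi.symm x := by simp [it]
lemma it_add (i j : ℤ) (x : X) : it S i (it S j x) = it S (i + j) x := by
  simp [it, zpow_add, Equiv.Perm.mul_apply]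
lemma it_cont (i : ℤ) : Continuous (it S i) := by
  induction i using Int.induction_on with
  | zero => exact continuous_id.congr (fun x => (it_zero S x).symm)
  | succ n ih =>
    refine (S.phi_cont.comp ih).congr (fun x => ?_)
    rw [Function.comp, ← it_one, it_add, add_comm]
  | pred n ih =>
    refine (S.phi_symm_cont.comp ih).congr (fun x => ?_)
    rw [Function.comp, ← it_neg_one, it_add]; congr 1; ring
lemma it_nat (n : ℕ) (x : X) : it S n x = (⇑S.phi)^[n] x := by
  simp [it, Equiv.Perm.iterate_eq_pow]

/-- homeomorphism -/
def ith (i : ℤ) : X ≃ₜ X where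
  toFun := it S i
  invFun := it S (-i)
  left_inv x := by rw [it_add]; simp [it_zero]
  right_inv x := by rw [it_add]; simp [it_zero]
  continuous_toFun := it_cont S i
  continuous_invFun := it_cont S (-i)
end

/-- Working hypotheses. -/
structure Setup (S : SmaleSpace X) (R1 : Set (Set X)) (e : ℝ) : Prop where
  e_pos : 0 < e
  e_lt : 24 * e < S.eps
  br_near : ∀ x y : X, dist x y ≤ 2 * e → dist x (S.bracket x y) < S.eps / 2 ∧
    dist y (S.bracket x y) < S.eps / 2
  fin : R1.Finite
  cov : ∀ x : X, ∃ R ∈ R1, x ∈ R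
  dle : ∀ R ∈ R1, ∀ x ∈ R, ∀ y ∈ R, dist x y ≤ e / 2
  brm : ∀ R ∈ R1, ∀ x ∈ R, ∀ y ∈ R, S.bracket x y ∈ R
  closed : ∀ R ∈ R1, IsClosed R
  clint : ∀ R ∈ R1, R ⊆ closure (interior R)
  intne : ∀ R ∈ R1, (interior R).Nonempty
  disj : ∀ R ∈ R1, ∀ R' ∈ R1, ∀ x, x ∈ interior R → x ∈ interior R' → R = R'
  mk_s : ∀ R ∈ R1, ∀ R' ∈ R1, ∀ x y, x ∈ interior R → it S 1 x ∈ interior R' →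
    y ∈ R → S.bracket x y = y → it S 1 y ∈ R'
  mk_u : ∀ R ∈ R1, ∀ R' ∈ R1, ∀ x y, it S (-1) x ∈ interior R → x ∈ interior R' →
    y ∈ R' → S.bracket y x = y → it S (-1) y ∈ R
  mix : ∀ U V : Set X, IsOpen U → IsOpen V → U.Nonempty → V.Nonempty →
    ∃ N : ℕ, ∀ n ≥ N, ∃ x ∈ U, it S (n : ℤ) x ∈ V

section
variable {S : SmaleSpace X} {R1 : Set (Set X)} {e : ℝ} (hs : Setup S R1 e)
include hs

lemma br_s {x y : X} (h : dist x y ≤ 2 * e) :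
    S.bracket x (S.bracket x y) = S.bracket x y := by
  have h1 := hs.br_near x y h
  have h2 := hs.e_lt
  have h3 := hs.e_pos
  exact S.bracket_assoc₁ x x y (by linarith) (by linarith [h1.1, S.eps_pos]) (by linarith)

lemma br_u {x y : X} (h : dist x y ≤ 2 * e) :
    S.bracket (S.bracket x y) y = S.bracket x y := by
  have h1 := hs.br_near x y h
  have h2 := hs.e_lt
  have h3 := hs.e_pos
  refine S.bracket_assoc₂ x y y (by linarith) ?_ (by linarith)
  rw [dist_comm]; linarith [h1.2, S.eps_pos]

omit hs in
lemma br_it {x y : X} (n : ℕ) (h : ∀ i : ℤ, 0 ≤ i → i ≤ n → dist (it S i x) (it S i y) ≤ S.eps) :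
    it S n (S.bracket x y) = S.bracket (it S n x) (it S n y) := by
  induction n with
  | zero => simp [it_zero]
  | succ n ih =>
    have h1 := ih (fun i h0 h1 => h i h0 (by push_cast; linarith))
    have e1 : ∀ z : X, it S ((n + 1 : ℕ) : ℤ) z = S.phi (it S n z) := by
      intro z; rw [← it_one, it_add]; congr 1; push_cast; ring
    rw [e1, e1, e1, h1]
    refine S.bracket_phi _ _ (h n (by positivity) (by push_cast; linarith)) ?_
    rw [← e1, ← e1]
    exact h _ (by positivity) le_rfl

/-- forward Markov -/
lemma fwd {w : ℤ → Set X} (n : ℕ) {x y : X} 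
    (hx : ∀ i : ℤ, 0 ≤ i → i ≤ n → w i ∈ R1 ∧ it S i x ∈ interior (w i))
    (hy : y ∈ w 0) (hb : S.bracket x y = y) (i : ℕ) (hi : i ≤ n) :
    it S i y ∈ w i ∧ S.bracket (it S i x) (it S i y) = it S i y := by
  induction i with
  | zero => simpa [it_zero] using ⟨hy, hb⟩
  | succ i ih =>
    have h1 := ih (by omega)
    have e1 : ∀ z : X, it S ((i + 1 : ℕ) : ℤ) z = it S 1 (it S i z) := by
      intro z; rw [it_add]; congr 1; push_cast; ring
    have a1 := hx i (by positivity) (by exact_mod_cast (by omega : i ≤ n))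
    have a2 := hx (i+1 : ℕ) (by positivity) (by exact_mod_cast hi)
    have k1 : it S ((i + 1 : ℕ) : ℤ) y ∈ w ((i+1 : ℕ) : ℤ) := by
      rw [e1]; exact hs.mk_s _ a1.1 _ a2.1 _ _ a1.2 (by rw [← e1]; exact a2.2) h1.1 h1.2
    refine ⟨k1, ?_⟩
    have d1 := hs.dle _ a1.1 _ (interior_subset a1.2) _ h1.1
    have d2 := hs.dle _ a2.1 _ (interior_subset a2.2) _ k1
    have h2 := hs.e_lt
    have h3 := hs.e_pos
    have := S.bracket_phi (it S i x) (it S i y) (by linarith)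
      (by rw [← it_one, ← it_one, ← e1, ← e1]; linarith)
    rw [h1.2, ← it_one, ← it_one, ← e1, ← e1] at this
    exact this.symm

/-- backward Markov -/
lemma bwd {w : ℤ → Set X} (n : ℕ) {x y : X} 
    (hx : ∀ i : ℤ, -n ≤ i → i ≤ 0 → w i ∈ R1 ∧ it S i x ∈ interior (w i))
    (hy : y ∈ w 0) (hb : S.bracket y x = y) (i : ℕ) (hi : i ≤ n) :
    it S (-(i:ℤ)) y ∈ w (-i) ∧ S.bracket (it S (-i) y) (it S (-i) x) = it S (-i) y := by
  induction i with
  | zero => simpa [it_zero] using ⟨hy, hb⟩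
  | succ i ih =>
    have h1 := ih (by omega)
    have e1 : ∀ z : X, it S (-((i + 1 : ℕ) : ℤ)) z = it S (-1) (it S (-i) z) := by
      intro z; rw [it_add]; congr 1; push_cast; ring
    have e2 : ∀ z : X, it S (-(i:ℤ)) z = it S 1 (it S (-((i + 1 : ℕ) : ℤ)) z) := by
      intro z; rw [it_add]; congr 1; push_cast; ring
    have a1 := hx (-i) (by omega) (by omega)
    have a2 := hx (-(i+1 : ℕ)) (by omega) (by omega)
    have k1 : it S (-((i + 1 : ℕ) : ℤ)) y ∈ w (-((i+1 : ℕ) : ℤ)) := by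
      rw [e1]; exact hs.mk_u _ a2.1 _ a1.1 _ _ (by rw [← e1]; exact a2.2) a1.2 h1.1 h1.2
    refine ⟨k1, ?_⟩
    have d1 := hs.dle _ a1.1 _ h1.1 _ (interior_subset a1.2)
    have d2 := hs.dle _ a2.1 _ k1 _ (interior_subset a2.2)
    have h2 := hs.e_lt
    have h3 := hs.e_pos
    have h4 := hs.br_near _ _ (show dist (it S (-((i + 1 : ℕ) : ℤ)) y) (it S (-((i + 1 : ℕ) : ℤ)) x) ≤ 2 * e by linarith)
    have := S.bracket_phi (it S (-((i + 1 : ℕ) : ℤ)) y) (it S (-((i + 1 : ℕ) : ℤ)) x) (by linarith)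
      (by rw [← it_one, ← it_one, ← e2, ← e2]; linarith)
    rw [← it_one, ← it_one, ← it_one, ← e2 x, ← e2 y, h1.2, e2] at this
    exact (ith S 1).injective this

/-- The bracket is open. -/
lemma br_open {x y : X} (h : dist x y ≤ e) {A B : Set X} (hA : A ∈ 𝓝 x) (hB : B ∈ 𝓝 y) :
    ∀ᶠ z in 𝓝 (S.bracket x y), ∃ x' ∈ A, ∃ y' ∈ B, dist x' y' ≤ 2 * e ∧ z = S.bracket x' y' := by
  have h2 := hs.e_lt
  have h3 := hs.e_pos
  have n1 := hs.br_near x y (by linarith)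
  set z0 := S.bracket x y with hz0
  have hcont : ∀ a b : X, dist a b < S.eps →
      ContinuousAt (fun p : X × X => S.bracket p.1 p.2) (a, b) := by
    intro a b hab
    refine S.bracket_cont.continuousAt ?_
    have : IsOpen {p : X × X | dist p.1 p.2 < S.eps} :=
      isOpen_lt (by fun_prop) continuous_const
    exact Filter.mem_of_superset (this.mem_nhds hab) (fun p hp => le_of_lt (show dist p.1 p.2 < S.eps from hp))
  have e1 : S.bracket z0 x = x := by
    rw [hz0, S.bracket_assoc₂ x y x (by linarith) (by rw [dist_comm]; linarith [S.eps_pos])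
      (by simp [S.eps_pos.le]), S.bracket_self]
  have e2 : S.bracket y z0 = y := by
    rw [hz0, S.bracket_assoc₁ y x y (by linarith) (by linarith [S.eps_pos])
      (by simp [S.eps_pos.le]), S.bracket_self]
  have c1 : ContinuousAt (fun z => S.bracket z x) z0 :=
    ContinuousAt.comp (f := fun z => (z, x)) (hcont z0 x (by rw [dist_comm]; linarith [S.eps_pos])) (by fun_prop)
  have c2 : ContinuousAt (fun z => S.bracket y z) z0 :=
    ContinuousAt.comp (f := fun z => (y, z)) (hcont y z0 (by linarith [S.eps_pos])) (by fun_prop)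
  have t1 : Filter.Tendsto (fun z => S.bracket z x) (𝓝 z0) (𝓝 x) := by
    have := c1.tendsto; rwa [e1] at this
  have t2 : Filter.Tendsto (fun z => S.bracket y z) (𝓝 z0) (𝓝 y) := by
    have := c2.tendsto; rwa [e2] at this
  have dd : ∀ᶠ z in 𝓝 z0, dist (S.bracket z x) (S.bracket y z) < 2 * e :=
    (t1.dist t2).eventually (gt_mem_nhds (by linarith))
  have d3 : ∀ᶠ z in 𝓝 z0, dist z x < S.eps := 
    (Filter.Tendsto.dist Filter.tendsto_id tendsto_const_nhds).eventually
      (gt_mem_nhds (by rw [dist_comm]; linarith [S.eps_pos]))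
  have d4 : ∀ᶠ z in 𝓝 z0, dist y z < S.eps := 
    (Filter.Tendsto.dist tendsto_const_nhds Filter.tendsto_id).eventually
      (gt_mem_nhds (by linarith [S.eps_pos]))
  have d5 : ∀ᶠ z in 𝓝 z0, dist z (S.bracket y z) < S.eps :=
    (Filter.Tendsto.dist Filter.tendsto_id t2).eventually
      (gt_mem_nhds (by rw [dist_comm]; linarith [S.eps_pos]))
  filter_upwards [t1.eventually hA, t2.eventually hB, dd, d3, d4, d5] with z a1 a2 a3 a4 a5 a6
  refine ⟨_, a1, _, a2, a3.le, ?_⟩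
  rw [S.bracket_assoc₂ z x _ a4.le (by linarith) a6.le,
    S.bracket_assoc₁ z y z a5.le a6.le (by simp [S.eps_pos.le]), S.bracket_self]

end
end SB

open Set Metric MeasureTheory Topology
open scoped ENNReal NNReal
namespace SB
variable {X : Type*} [MetricSpace X]

/-- generic points -/
def Gen (S : SmaleSpace X) (R1 : Set (Set X)) : Set X :=
  {x | ∀ i : ℤ, ∃ R ∈ R1, it S i x ∈ interior R}

open Classical in
/-- code of a point -/
noncomputable def cd (R1 : Set (Set X)) (x : X) : Set X :=
  if h : ∃ R ∈ R1, x ∈ interior R then h.choose else ∅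

section
variable {S : SmaleSpace X} {R1 : Set (Set X)} {e : ℝ} (hs : Setup S R1 e)

lemma gen_cd {x : X} (hx : x ∈ Gen S R1) (i : ℤ) :
    cd R1 (it S i x) ∈ R1 ∧ it S i x ∈ interior (cd R1 (it S i x)) := by
  have h := hx i
  rw [cd, dif_pos h]
  exact h.choose_spec

lemma gen_cd0 {x : X} (hx : x ∈ Gen S R1) :
    cd R1 x ∈ R1 ∧ x ∈ interior (cd R1 x) := by
  have := gen_cd hx 0
  rwa [it_zero] at this

lemma gen_it {x : X} (hx : x ∈ Gen S R1) (j : ℤ) : it S j x ∈ Gen S R1 := by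
  intro i; rw [it_add]; exact hx _

include hs

lemma cd_eq {x : X} (hx : x ∈ Gen S R1) {R : Set X} (hR : R ∈ R1) (h : x ∈ R) : cd R1 x = R := by
  have h1 := gen_cd0 hx
  have h2 := hs.clint R hR h
  rw [_root_.mem_closure_iff] at h2
  obtain ⟨y, hy1, hy2⟩ := h2 _ isOpen_interior h1.2
  exact hs.disj _ h1.1 _ hR y hy1 hy2

lemma gen_dense [CompactSpace X] : Dense (Gen S R1) := by
  have : Gen S R1 = ⋂ i : ℤ, (it S i) ⁻¹' (⋃ R ∈ R1, interior R) := by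
    ext x; simp [Gen]
  rw [this]
  have ho : IsOpen (⋃ R ∈ R1, interior R) := isOpen_biUnion (fun _ _ => isOpen_interior)
  have hd : Dense (⋃ R ∈ R1, interior R) := by
    intro x
    obtain ⟨R, hR, hx⟩ := hs.cov x
    exact closure_mono (subset_biUnion_of_mem (u := fun R : Set X => interior R) hR) (hs.clint R hR hx)
  refine dense_iInter_of_isOpen (fun i => ho.preimage (it_cont S i)) (fun i => ?_)
  exact hd.preimage (ith S i).isOpenMap

lemma exists_gen [CompactSpace X] {U : Set X} (hU : IsOpen U) (hne : U.Nonempty) :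
    ∃ x ∈ Gen S R1, x ∈ U := by
  obtain ⟨x, h1, h2⟩ := (gen_dense hs).inter_open_nonempty U hU hne
  exact ⟨x, h2, h1⟩

lemma small_dist {R : Set X} (hR : R ∈ R1) {x y : X} (hx : x ∈ R) (hy : y ∈ R) :
    dist x y ≤ e ∧ dist x y ≤ 2 * e ∧ dist x y < S.eps := by
  have := hs.dle R hR x hx y hy
  have h1 := hs.e_pos
  have h2 := hs.e_lt
  refine ⟨by linarith, by linarith, by linarith⟩

/-- neighbourhood of points with the same code on a window -/
lemma win_nhds {x : X} (hx : x ∈ Gen S R1) (a b : ℤ) :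
    {x' : X | ∀ i : ℤ, a ≤ i → i ≤ b → it S i x' ∈ interior (cd R1 (it S i x))} ∈ 𝓝 x := by
  have : {x' : X | ∀ i : ℤ, a ≤ i → i ≤ b → it S i x' ∈ interior (cd R1 (it S i x))}
      = ⋂ i ∈ Set.Icc a b, (it S i) ⁻¹' (interior (cd R1 (it S i x))) := by
    ext; simp
  rw [this, Filter.biInter_mem (Set.finite_Icc a b)]
  intro i _
  exact (isOpen_interior.preimage (it_cont S i)).mem_nhds (gen_cd hx i).2

/-- the bracket point follows both codes, non generic version -/
lemma bracket_follow {w : ℤ → Set X} (m k : ℕ) {x y : X}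
    (hx : ∀ i : ℤ, -m ≤ i → i ≤ 0 → w i ∈ R1 ∧ it S i x ∈ interior (w i))
    (hy : ∀ i : ℤ, 0 ≤ i → i ≤ k → w i ∈ R1 ∧ it S i y ∈ interior (w i)) :
    ∀ i : ℤ, -m ≤ i → i ≤ k → it S i (S.bracket y x) ∈ w i := by
  have x0 := hx 0 (by omega) le_rfl
  have y0 := hy 0 le_rfl (by omega)
  rw [it_zero] at x0 y0
  have x00 := interior_subset x0.2
  have y00 := interior_subset y0.2
  have hz : S.bracket y x ∈ w 0 := hs.brm _ x0.1 _ y00 _ x00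
  have hd := (small_dist hs x0.1 y00 x00).2.1
  intro i h1 h2
  rcases le_total 0 i with h | h
  · obtain ⟨n, rfl⟩ := Int.eq_ofNat_of_zero_le h
    exact (fwd hs k hy hz (br_s hs hd) n (by exact_mod_cast h2)).1
  · obtain ⟨n, hn⟩ := Int.eq_ofNat_of_zero_le (show 0 ≤ -i by omega)
    have : i = -(n : ℤ) := by omega
    subst this
    exact (bwd hs m hx hz (br_u hs hd) n (by omega)).1

lemma glue0 [CompactSpace X] (m k : ℕ) {x y : X} (hx : x ∈ Gen S R1) (hy : y ∈ Gen S R1) 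
    (hxy : cd R1 x = cd R1 y) :
    ∃ z ∈ Gen S R1, (∀ i : ℤ, -m ≤ i → i ≤ 0 → cd R1 (it S i z) = cd R1 (it S i x)) ∧
      (∀ i : ℤ, 0 ≤ i → i ≤ k → cd R1 (it S i z) = cd R1 (it S i y)) := by
  have x0 := gen_cd0 hx
  have y0 := gen_cd0 hy
  have hd := (small_dist hs y0.1 (interior_subset y0.2) (hxy ▸ interior_subset x0.2)).1
  have key := br_open hs hd (win_nhds hs hy 0 k) (win_nhds hs hx (-m) 0)
  rw [_root_.eventually_nhds_iff] at key
  obtain ⟨U, hU, hUo, hUm⟩ := key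
  obtain ⟨z, hz, hzU⟩ := exists_gen hs hUo ⟨_, hUm⟩
  obtain ⟨y', hy', x', hx', -, rfl⟩ := hU z hzU
  refine ⟨_, hz, ?_⟩
  set w : ℤ → Set X := fun i => if i ≤ 0 then cd R1 (it S i x) else cd R1 (it S i y) with hw
  have w1 : ∀ i ≤ 0, w i = cd R1 (it S i x) := by intro i hi; simp [hw, hi]
  have w2 : ∀ i ≥ 0, w i = cd R1 (it S i y) := by
    intro i hi
    rcases hi.lt_or_eq with h | h
    · simp [hw, h]
    · subst h; simp [hw, it_zero, hxy]
  have fol := bracket_follow hs (w := w) m k (x := x') (y := y')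
    (fun i h1 h2 => by rw [w1 i h2]; exact ⟨(gen_cd hx i).1, hx' i h1 h2⟩)
    (fun i h1 h2 => by rw [w2 i h1]; exact ⟨(gen_cd hy i).1, hy' i h1 h2⟩)
  constructor
  · intro i h1 h2
    have := fol i h1 (by omega)
    rw [w1 i h2] at this
    exact cd_eq hs (gen_it hz i) (gen_cd hx i).1 this
  · intro i h1 h2
    have := fol i (by omega) h2
    rw [w2 i h1] at this
    exact cd_eq hs (gen_it hz i) (gen_cd hy i).1 this

lemma mix_unif {ι : Type*} [Finite ι] (U V : ι → Set X) (hU : ∀ i, IsOpen (U i))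
    (hV : ∀ i, IsOpen (V i)) (hU' : ∀ i, (U i).Nonempty) (hV' : ∀ i, (V i).Nonempty) :
    ∃ N : ℕ, ∀ n ≥ N, ∀ i, ∃ x ∈ U i, it S (n : ℤ) x ∈ V i := by
  choose N hN using fun i => hs.mix (U i) (V i) (hU i) (hV i) (hU' i) (hV' i)
  obtain ⟨M, hM⟩ := (Set.finite_range N).bddAbove
  exact ⟨M, fun n hn i => hN i n ((hM ⟨i, rfl⟩).trans hn)⟩

lemma glue [CompactSpace X] : ∃ p : ℕ, ∀ (m k : ℕ) (x y : X), x ∈ Gen S R1 → y ∈ Gen S R1 →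
    ∃ z ∈ Gen S R1, (∀ i : ℤ, -m ≤ i → i ≤ 0 → cd R1 (it S i z) = cd R1 (it S i x)) ∧
      (∀ i : ℤ, 0 ≤ i → i ≤ k → cd R1 (it S (p + i) z) = cd R1 (it S i y)) := by
  have := hs.fin.to_subtype
  obtain ⟨p, hp⟩ := mix_unif hs (ι := R1 × R1) (fun a => interior a.1.1) (fun a => interior a.2.1)
    (fun _ => isOpen_interior) (fun _ => isOpen_interior) (fun a => hs.intne _ a.1.2)
    (fun a => hs.intne _ a.2.2)
  refine ⟨p, fun m k x y hx hy => ?_⟩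
  have x0 := gen_cd0 hx
  have y0 := gen_cd0 hy
  obtain ⟨t, t1, t2⟩ := hp p le_rfl (⟨_, x0.1⟩, ⟨_, y0.1⟩)
  simp only at t1 t2
  obtain ⟨t, ht, t1, t2⟩ := exists_gen hs
    (U := interior (cd R1 x) ∩ it S p ⁻¹' (interior (cd R1 y)))
    (isOpen_interior.inter (isOpen_interior.preimage (it_cont S _))) ⟨t, t1, t2⟩
  have c1 := cd_eq hs ht x0.1 (interior_subset t1)
  have c2 := cd_eq hs (gen_it ht p) y0.1 (interior_subset t2)
  obtain ⟨u, hu, u1, u2⟩ := glue0 hs p k (gen_it ht p) hy c2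
  have c3 := u1 (-p) le_rfl (by omega)
  rw [it_add, neg_add_cancel, it_zero, c1] at c3
  obtain ⟨z, hz, z1, z2⟩ := glue0 hs m (p + k) hx (gen_it hu (-p)) c3.symm
  refine ⟨z, hz, z1, fun i h1 h2 => ?_⟩
  rw [z2 _ (by omega) (by push_cast; omega), it_add, ← u2 i h1 h2]
  congr 2; ring

/-- injectivity of coding -/
lemma code_inj (m : ℕ) {x y : X} (hx : x ∈ Gen S R1) (hy : y ∈ Gen S R1)
    (h0 : cd R1 x = cd R1 y) (hm : cd R1 (it S m x) = cd R1 (it S m y))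
    (hd : ∀ i : ℤ, 0 ≤ i → i ≤ m → dist (it S i x) (it S i y) < S.eps) :
    ∀ i : ℤ, 0 ≤ i → i ≤ m → cd R1 (it S i x) = cd R1 (it S i y) := by
  have x0 := gen_cd0 hx
  have y0 := gen_cd0 hy
  have hd0 := (small_dist hs x0.1 (interior_subset x0.2) (h0 ▸ interior_subset y0.2)).1
  have hfar : {p : X × X | ∀ i : ℤ, 0 ≤ i → i ≤ m → dist (it S i p.1) (it S i p.2) < S.eps} ∈ 𝓝 (x, y) := by
    have : {p : X × X | ∀ i : ℤ, 0 ≤ i → i ≤ m → dist (it S i p.1) (it S i p.2) < S.eps} =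
      ⋂ i ∈ Set.Icc (0:ℤ) m, {p : X × X | dist (it S i p.1) (it S i p.2) < S.eps} := by
      ext; simp
    rw [this, Filter.biInter_mem (Set.finite_Icc _ _)]
    intro i hi
    refine IsOpen.mem_nhds (isOpen_lt ?_ continuous_const) (hd i hi.1 hi.2)
    have := it_cont S i
    fun_prop
  rw [nhds_prod_eq, Filter.mem_prod_iff] at hfar
  obtain ⟨A, hA, B, hB, hAB⟩ := hfar
  have key := br_open hs hd0 (Filter.inter_mem hA (win_nhds hs hx 0 m))
    (Filter.inter_mem hB (win_nhds hs hy 0 m))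
  rw [_root_.eventually_nhds_iff] at key
  obtain ⟨U, hU, hUo, hUm⟩ := key
  have hboth : ∀ z ∈ U, ∀ i : ℤ, 0 ≤ i → i ≤ m → 
      it S i z ∈ cd R1 (it S i x) ∧ it S i z ∈ cd R1 (it S i y) := by
    intro z hz
    obtain ⟨x', ⟨hA', hx'⟩, y', ⟨hB', hy'⟩, hd2, rfl⟩ := hU z hz
    have hdd : ∀ i : ℤ, 0 ≤ i → i ≤ m → dist (it S i x') (it S i y') < S.eps :=
      hAB (Set.mk_mem_prod hA' hB')
    have x'0 := interior_subset (hx' 0 le_rfl (by omega))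
    have y'0 := interior_subset (hy' 0 le_rfl (by omega))
    simp only [it_zero] at x'0 y'0
    have x'm := interior_subset (hx' m (by omega) le_rfl)
    have y'm := interior_subset (hy' m (by omega) le_rfl)
    intro i h1 h2
    obtain ⟨n, rfl⟩ := Int.eq_ofNat_of_zero_le h1
    constructor
    · refine (fwd hs (w := fun i => cd R1 (it S i x)) m (x := x') 
        (fun i h1 h2 => ⟨(gen_cd hx i).1, hx' i h1 h2⟩) ?_ (br_s hs hd2) n (by exact_mod_cast h2)).1
      simp only [it_zero]
      exact hs.brm _ x0.1 _ x'0 _ (h0 ▸ y'0)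
    · have e1 := br_it (S := S) (x := x') (y := y') m (fun i h1 h2 => (hdd i h1 h2).le)
      have hdm := (small_dist hs (gen_cd hx m).1 x'm (hm ▸ y'm)).2.1
      have := (bwd hs (w := fun i => cd R1 (it S (m + i) y)) m (x := it S m y') 
        (y := S.bracket (it S m x') (it S m y'))
        (fun i h1 h2 => ⟨(gen_cd hy _).1, by 
          rw [it_add, add_comm i]; exact hy' _ (by omega) (by omega)⟩) ?_ (br_u hs hdm) (m - n) (by omega)).1
      · rw [← e1, it_add] at this
        have h3 : -(((m - n : ℕ)) : ℤ) + m = n := by omega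
        have h4 : (m : ℤ) + -(((m - n : ℕ)) : ℤ) = n := by omega
        simp only [h3, h4] at this
        exact this
      · simp only [add_zero]
        exact hs.brm _ (gen_cd hy m).1 _ (hm ▸ x'm) _ y'm
  intro i h1 h2
  have hV : IsOpen (it S i '' U) := (ith S i).isOpenMap U hUo
  have k1 : it S i '' U ⊆ cd R1 (it S i x) := by
    rintro _ ⟨z, hz, rfl⟩; exact (hboth z hz i h1 h2).1
  have k2 : it S i '' U ⊆ cd R1 (it S i y) := by
    rintro _ ⟨z, hz, rfl⟩; exact (hboth z hz i h1 h2).2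
  exact hs.disj _ (gen_cd hx i).1 _ (gen_cd hy i).1 _ (interior_maximal k1 hV ⟨_, hUm, rfl⟩)
    (interior_maximal k2 hV ⟨_, hUm, rfl⟩)

end
end SB

open Set Metric MeasureTheory Topology
open scoped ENNReal NNReal
namespace SB
variable {X : Type*} [MetricSpace X]
section
variable {S : SmaleSpace X} {R1 : Set (Set X)} {e : ℝ} 

lemma contr_s (n : ℕ) {x z : X} (h : ∀ i : ℕ, i < n → dist (it S i x) (it S i z) < S.eps ∧ 
    S.bracket (it S i x) (it S i z) = it S i z) :
    dist (it S n x) (it S n z) ≤ (S.lam⁻¹) ^ n * dist x z := by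
  induction n with
  | zero => simp [it_zero]
  | succ n ih =>
    have h1 := ih (fun i hi => h i (by omega))
    have h2 := h n (by omega)
    have e1 : ∀ z : X, it S ((n + 1 : ℕ) : ℤ) z = S.phi (it S n z) := by
      intro z; rw [← it_one, it_add]; congr 1; push_cast; ring
    have h3 := S.contract_s (it S n x) S.eps S.eps_pos le_rfl (it S n x) (it S n z)
      (by simp [S.eps_pos]) (S.bracket_self _) h2.1 h2.2
    rw [e1, e1, pow_succ', mul_assoc]
    have := S.one_lt_lam
    exact h3.trans (mul_le_mul_of_nonneg_left h1 (by positivity))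

lemma contr_u (n : ℕ) {x z : X} (h : ∀ i : ℕ, i < n → dist (it S (-i) x) (it S (-i) z) < S.eps ∧ 
    S.bracket (it S (-i) z) (it S (-i) x) = it S (-i) z) :
    dist (it S (-n) x) (it S (-n) z) ≤ (S.lam⁻¹) ^ n * dist x z := by
  induction n with
  | zero => simp [it_zero]
  | succ n ih =>
    have h1 := ih (fun i hi => h i (by omega))
    have h2 := h n (by omega)
    have e1 : ∀ z : X, it S (-((n + 1 : ℕ) : ℤ)) z = S.phi.symm (it S (-n) z) := by
      intro z; rw [← it_neg_one, it_add]; congr 1; push_cast; ring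
    have h3 := S.contract_u (it S (-n) x) S.eps S.eps_pos le_rfl (it S (-n) x) (it S (-n) z)
      (by simp [S.eps_pos]) (S.bracket_self _) h2.1 h2.2
    rw [e1, e1, pow_succ', mul_assoc]
    have := S.one_lt_lam
    exact h3.trans (mul_le_mul_of_nonneg_left h1 (by positivity))

lemma lip_it {L : ℝ} (hL : 0 ≤ L) (hl : ∀ x y, dist (S.phi x) (S.phi y) ≤ L * dist x y) (n : ℕ) (x y : X) :
    dist (it S n x) (it S n y) ≤ L ^ n * dist x y := by
  induction n with
  | zero => simp [it_zero]
  | succ n ih =>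
    have e1 : ∀ z : X, it S ((n + 1 : ℕ) : ℤ) z = S.phi (it S n z) := by
      intro z; rw [← it_one, it_add]; congr 1; push_cast; ring
    rw [e1, e1, pow_succ', mul_assoc]
    exact (hl _ _).trans (mul_le_mul_of_nonneg_left ih hL)

lemma lip_it' {L : ℝ} (hL : 0 ≤ L) (hl : ∀ x y, dist (S.phi.symm x) (S.phi.symm y) ≤ L * dist x y) (n : ℕ) (x y : X) :
    dist (it S (-n) x) (it S (-n) y) ≤ L ^ n * dist x y := by
  induction n with
  | zero => simp [it_zero]
  | succ n ih =>
    have e1 : ∀ z : X, it S (-((n + 1 : ℕ) : ℤ)) z = S.phi.symm (it S (-n) z) := by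
      intro z; rw [← it_neg_one, it_add]; congr 1; push_cast; ring
    rw [e1, e1, pow_succ', mul_assoc]
    exact (hl _ _).trans (mul_le_mul_of_nonneg_left ih hL)

variable (hs : Setup S R1 e)
include hs

lemma diam_upper (k : ℕ) {x y : X} 
    (h : ∀ i : ℤ, -k ≤ i → i ≤ k → ∃ R ∈ R1, it S i x ∈ R ∧ it S i y ∈ R) :
    dist x y ≤ e * (S.lam⁻¹) ^ k := by
  set x' := it S (-k) x with hx'
  set y' := it S (-k) y with hy'
  set z' := S.bracket x' y' with hz'
  have hh : ∀ j : ℕ, j ≤ 2 * k → ∃ R ∈ R1, it S j x' ∈ R ∧ it S j y' ∈ R ∧ it S j z' ∈ R ∧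
      it S j z' = S.bracket (it S j x') (it S j y') := by
    have h0 : ∀ j : ℤ, 0 ≤ j → j ≤ 2 * k → ∃ R ∈ R1, it S j x' ∈ R ∧ it S j y' ∈ R := by
      intro j h1 h2
      obtain ⟨R, hR, a, b⟩ := h (j - k) (by omega) (by omega)
      exact ⟨R, hR, by rw [hx', it_add]; exact a, by rw [hy', it_add]; exact b⟩
    intro j hj
    obtain ⟨R, hR, a, b⟩ := h0 j (by omega) (by omega)
    have h1 := br_it (S := S) (x := x') (y := y') j (fun i h1 h2 => by
      obtain ⟨R, hR, a, b⟩ := h0 i h1 (by omega)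
      exact (small_dist hs hR a b).2.2.le)
    refine ⟨R, hR, a, b, ?_, h1⟩
    rw [hz', h1]; exact hs.brm R hR _ a _ b
  have hS : ∀ j : ℕ, j ≤ 2 * k → dist (it S j x') (it S j z') < S.eps ∧ 
      dist (it S j x') (it S j z') ≤ e / 2 ∧
      S.bracket (it S j x') (it S j z') = it S j z' := by
    intro j hj
    obtain ⟨R, hR, a, b, c, d⟩ := hh j hj
    refine ⟨(small_dist hs hR a c).2.2, hs.dle R hR _ a _ c, ?_⟩
    rw [d]; exact br_s hs (small_dist hs hR a b).2.1
  have hU : ∀ j : ℕ, j ≤ 2 * k → dist (it S j y') (it S j z') < S.eps ∧ 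
      dist (it S j y') (it S j z') ≤ e / 2 ∧
      S.bracket (it S j z') (it S j y') = it S j z' := by
    intro j hj
    obtain ⟨R, hR, a, b, c, d⟩ := hh j hj
    refine ⟨(small_dist hs hR b c).2.2, hs.dle R hR _ b _ c, ?_⟩
    rw [d]; exact br_u hs (small_dist hs hR a b).2.1
  have ex : it S k x' = x := by rw [hx', it_add]; simp [it_zero]
  have ey : it S k y' = y := by rw [hy', it_add]; simp [it_zero]
  clear_value z' x' y'
  have k1 := contr_s (S := S) k (x := x') (z := z') (fun i hi => 
    ⟨(hS i (by omega)).1, (hS i (by omega)).2.2⟩)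
  have k2 := contr_u (S := S) k (x := it S (2 * k : ℕ) y') (z := it S (2 * k : ℕ) z') (fun i hi => by
    have := hU (2 * k - i) (by omega)
    rw [it_add, it_add, show -(i:ℤ) + (2 * k : ℕ) = (2 * k - i : ℕ) by omega]
    exact ⟨this.1, this.2.2⟩)
  rw [it_add, it_add, show -(k:ℤ) + (2 * k : ℕ) = k by omega, ey] at k2
  rw [ex] at k1
  have b1 := (hS 0 (by omega)).2.1
  simp only [Nat.cast_zero, it_zero] at b1
  have b2 := (hU (2 * k) le_rfl).2.1
  have := S.one_lt_lam
  have hp : 0 ≤ (S.lam⁻¹) ^ k := by positivity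
  have := dist_triangle_right x y (it S k z')
  have c1 := mul_le_mul_of_nonneg_left b1 hp
  have c2 := mul_le_mul_of_nonneg_left b2 hp
  linarith

lemma exists_pow_small {D : ℝ} (hD : 0 < D) : ∃ P : ℕ, ∀ p ≥ P, (S.lam⁻¹) ^ p * e ≤ D := by
  have h1 := S.one_lt_lam
  have h0 : S.lam⁻¹ < 1 := inv_lt_one_of_one_lt₀ h1
  have hp : 0 ≤ S.lam⁻¹ := by positivity
  obtain ⟨P, hP⟩ := exists_pow_lt_of_lt_one (show 0 < D / e from div_pos hD hs.e_pos) h0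
  refine ⟨P, fun p hp' => ?_⟩
  have := pow_le_pow_of_le_one hp h0.le hp'
  rw [lt_div_iff₀ hs.e_pos] at hP
  exact (mul_le_mul_of_nonneg_right this hs.e_pos.le).trans hP.le

lemma diam_lower_u [CompactSpace X] [Nontrivial X] 
    (hl : ∀ x y, dist (S.phi x) (S.phi y) ≤ S.lam * dist x y) :
    ∃ c : ℝ, 0 < c ∧ ∀ (n : ℕ), ∀ x ∈ Gen S R1, ∃ a b : X, 
      (∀ i : ℤ, -n ≤ i → i ≤ n → it S i a ∈ cd R1 (it S i x) ∧ it S i b ∈ cd R1 (it S i x)) ∧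
      c * (S.lam⁻¹) ^ n ≤ dist a b := by
  have hlam := S.one_lt_lam
  have hlam0 : 0 < S.lam := by linarith
  obtain ⟨p0, q0, hpq⟩ := exists_pair_ne X
  set D := dist p0 q0 with hD
  have hDp : 0 < D := dist_pos.2 hpq
  obtain ⟨P, hP⟩ := exists_pow_small hs (show 0 < D / 8 by linarith)
  have := hs.fin.to_subtype
  obtain ⟨N, hN⟩ := mix_unif hs (ι := R1 × Bool) (fun a => interior a.1.1) 
    (fun a => ball (bif a.2 then p0 else q0) (D/8))
    (fun _ => isOpen_interior) (fun _ => isOpen_ball) (fun a => hs.intne _ a.1.2)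
    (fun a => ⟨_, mem_ball_self (by linarith)⟩)
  set p := max P N
  have main : ∀ (n : ℕ), ∀ x ∈ Gen S R1, ∀ t : Bool, ∃ a : X, 
      (∀ i : ℤ, -n ≤ i → i ≤ n → it S i a ∈ cd R1 (it S i x)) ∧ 
      dist (it S (n + p : ℕ) a) (bif t then p0 else q0) ≤ D / 4 := by
    intro n x hx t
    have hx' := gen_it hx n
    have g0 := gen_cd0 hx'
    obtain ⟨y, y1, y2⟩ := hN p (le_max_right _ _) (⟨_, g0.1⟩, t)
    obtain ⟨y, hy, y1, y2⟩ := exists_gen hs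
      (U := interior (cd R1 (it S n x)) ∩ it S p ⁻¹' (ball (bif t then p0 else q0) (D/8)))
      (isOpen_interior.inter (isOpen_ball.preimage (it_cont S _))) ⟨y, y1, y2⟩
    have c1 := cd_eq hs hy g0.1 (interior_subset y1)
    have hd := small_dist hs g0.1 (interior_subset y1) (interior_subset g0.2)
    set z := S.bracket y (it S n x) with hz
    have hzm : z ∈ cd R1 (it S n x) := hs.brm _ g0.1 _ (interior_subset y1) _ (interior_subset g0.2)
    have f1 := fwd hs (w := fun i => cd R1 (it S i y)) p (x := y) (y := z)
      (fun i _ _ => gen_cd hy i) (by simp only [it_zero, c1]; exact hzm) (br_s hs hd.2.1)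
    have f2 := contr_s p (x := y) (z := z) (fun i hi => 
      ⟨(small_dist hs (gen_cd hy i).1 (interior_subset (gen_cd hy i).2) (f1 i hi.le).1).2.2, (f1 i hi.le).2⟩)
    have f3 := bwd hs (w := fun i => cd R1 (it S i (it S n x))) (2 * n) (x := it S n x) (y := z)
      (fun i _ _ => gen_cd hx' i) (by simp only [it_zero]; exact hzm) (br_u hs hd.2.1)
    refine ⟨it S (-n) z, ?_, ?_⟩
    · intro i h1 h2
      obtain ⟨j, hj⟩ := Int.eq_ofNat_of_zero_le (show 0 ≤ n - i by omega)
      have := (f3 j (by omega)).1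
      rw [it_add] at this
      rw [it_add, show i + -(n:ℤ) = -(j : ℤ) by omega]
      rw [show -(j:ℤ) + (n:ℤ) = i by omega] at this
      exact this
    · rw [it_add, show ((n + p : ℕ) : ℤ) + -(n:ℤ) = p by push_cast; ring]
      have d1 := (small_dist hs g0.1 (interior_subset y1) hzm).1
      have d2 := mul_le_mul_of_nonneg_left d1 (show 0 ≤ (S.lam⁻¹) ^ p by positivity)
      have d3 := hP p (le_max_left _ _)
      have d4 : dist (it S p y) (bif t then p0 else q0) < D / 8 := y2
      have := dist_triangle_left (it S p z) (bif t then p0 else q0) (it S p y)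
      linarith
  refine ⟨D / 2 * (S.lam⁻¹) ^ p, by positivity, fun n x hx => ?_⟩
  obtain ⟨a, ha, ha'⟩ := main n x hx true
  obtain ⟨b, hb, hb'⟩ := main n x hx false
  refine ⟨a, b, fun i h1 h2 => ⟨ha i h1 h2, hb i h1 h2⟩, ?_⟩
  have l1 := lip_it hlam0.le hl (n + p) a b
  simp only [cond_true, cond_false] at ha' hb'
  have l2 : D ≤ dist p0 (it S (n + p : ℕ) a) + dist (it S (n + p : ℕ) a) (it S (n + p : ℕ) b) + 
    dist (it S (n + p : ℕ) b) q0 := dist_triangle4 _ _ _ _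
  rw [dist_comm p0] at l2
  have l3 : D / 2 ≤ S.lam ^ (n + p) * dist a b := by linarith
  rw [mul_assoc, ← pow_add, inv_pow, ← div_eq_mul_inv, div_le_iff₀ (by positivity), mul_comm (dist a b), add_comm p n]
  exact l3

lemma diam_lower_s [CompactSpace X] [Nontrivial X] 
    (hl : ∀ x y, dist (S.phi.symm x) (S.phi.symm y) ≤ S.lam * dist x y) :
    ∃ c : ℝ, 0 < c ∧ ∀ (n : ℕ), ∀ x ∈ Gen S R1, ∃ a b : X, 
      (∀ i : ℤ, -n ≤ i → i ≤ n → it S i a ∈ cd R1 (it S i x) ∧ it S i b ∈ cd R1 (it S i x)) ∧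
      c * (S.lam⁻¹) ^ n ≤ dist a b := by
  have hlam := S.one_lt_lam
  have hlam0 : 0 < S.lam := by linarith
  obtain ⟨p0, q0, hpq⟩ := exists_pair_ne X
  set D := dist p0 q0 with hD
  have hDp : 0 < D := dist_pos.2 hpq
  obtain ⟨P, hP⟩ := exists_pow_small hs (show 0 < D / 8 by linarith)
  have := hs.fin.to_subtype
  obtain ⟨N, hN⟩ := mix_unif hs (ι := R1 × Bool)
    (fun a => ball (bif a.2 then p0 else q0) (D/8)) (fun a => interior a.1.1) 
    (fun _ => isOpen_ball) (fun _ => isOpen_interior) 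
    (fun a => ⟨_, mem_ball_self (by linarith)⟩) (fun a => hs.intne _ a.1.2)
  set p := max P N
  have main : ∀ (n : ℕ), ∀ x ∈ Gen S R1, ∀ t : Bool, ∃ a : X, 
      (∀ i : ℤ, -n ≤ i → i ≤ n → it S i a ∈ cd R1 (it S i x)) ∧ 
      dist (it S (-(n + p : ℕ)) a) (bif t then p0 else q0) ≤ D / 4 := by
    intro n x hx t
    have hx' := gen_it hx (-n)
    have g0 := gen_cd0 hx'
    obtain ⟨y, y1, y2⟩ := hN p (le_max_right _ _) (⟨_, g0.1⟩, t)
    obtain ⟨y, hy, y1, y2⟩ := exists_gen hs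
      (U := interior (cd R1 (it S (-n) x)) ∩ it S (-p) ⁻¹' (ball (bif t then p0 else q0) (D/8)))
      (isOpen_interior.inter (isOpen_ball.preimage (it_cont S _))) ⟨it S p y, y2, by
        rw [mem_preimage, it_add, neg_add_cancel, it_zero]; exact y1⟩
    have c1 := cd_eq hs hy g0.1 (interior_subset y1)
    have hd := small_dist hs g0.1 (interior_subset g0.2) (interior_subset y1)
    set z := S.bracket (it S (-n) x) y with hz
    have hzm : z ∈ cd R1 (it S (-n) x) := hs.brm _ g0.1 _ (interior_subset g0.2) _ (interior_subset y1)
    have f1 := bwd hs (w := fun i => cd R1 (it S i y)) p (x := y) (y := z)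
      (fun i _ _ => gen_cd hy i) (by simp only [it_zero, c1]; exact hzm) (br_u hs hd.2.1)
    have f2 := contr_u p (x := y) (z := z) (fun i hi => 
      ⟨(small_dist hs (gen_cd hy _).1 (interior_subset (gen_cd hy _).2) (f1 i hi.le).1).2.2, (f1 i hi.le).2⟩)
    have f3 := fwd hs (w := fun i => cd R1 (it S i (it S (-n) x))) (2 * n) (x := it S (-n) x) (y := z)
      (fun i _ _ => gen_cd hx' i) (by simp only [it_zero]; exact hzm) (br_s hs hd.2.1)
    refine ⟨it S n z, ?_, ?_⟩
    · intro i h1 h2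
      obtain ⟨j, hj⟩ := Int.eq_ofNat_of_zero_le (show 0 ≤ n + i by omega)
      have := (f3 j (by omega)).1
      rw [it_add] at this
      rw [it_add, show i + (n:ℤ) = (j : ℤ) by omega]
      rw [show (j:ℤ) + -(n:ℤ) = i by omega] at this
      exact this
    · rw [it_add, show -((n + p : ℕ) : ℤ) + (n:ℤ) = -p by push_cast; ring]
      have d1 := (small_dist hs g0.1 (interior_subset y1) hzm).1
      have d2 := mul_le_mul_of_nonneg_left d1 (show 0 ≤ (S.lam⁻¹) ^ p by positivity)
      have d3 := hP p (le_max_left _ _)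
      have d4 : dist (it S (-p) y) (bif t then p0 else q0) < D / 8 := y2
      have := dist_triangle_left (it S (-p) z) (bif t then p0 else q0) (it S (-p) y)
      linarith
  refine ⟨D / 2 * (S.lam⁻¹) ^ p, by positivity, fun n x hx => ?_⟩
  obtain ⟨a, ha, ha'⟩ := main n x hx true
  obtain ⟨b, hb, hb'⟩ := main n x hx false
  refine ⟨a, b, fun i h1 h2 => ⟨ha i h1 h2, hb i h1 h2⟩, ?_⟩
  have l1 := lip_it' hlam0.le hl (n + p) a b
  simp only [cond_true, cond_false] at ha' hb'
  have l2 : D ≤ dist p0 (it S (-(n + p : ℕ)) a) + dist (it S (-(n + p : ℕ)) a) (it S (-(n + p : ℕ)) b) + 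
    dist (it S (-(n + p : ℕ)) b) q0 := dist_triangle4 _ _ _ _
  rw [dist_comm p0] at l2
  have l3 : D / 2 ≤ S.lam ^ (n + p) * dist a b := by linarith
  rw [mul_assoc, ← pow_add, inv_pow, ← div_eq_mul_inv, div_le_iff₀ (by positivity), mul_comm (dist a b), add_comm p n]
  exact l3
end
end SB

open Set Metric MeasureTheory Topology
open scoped ENNReal NNReal
namespace SB
variable {X : Type*} [MetricSpace X]

open Classical in
/-- word -/
noncomputable def wd (S : SmaleSpace X) (R1 : Set (Set X)) (m : ℕ) (x : X) : ℤ → Set X :=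
  fun i => if 0 ≤ i ∧ i < m then cd R1 (it S i x) else ∅

/-- set of words -/
def W (S : SmaleSpace X) (R1 : Set (Set X)) (m : ℕ) : Set (ℤ → Set X) := wd S R1 m '' Gen S R1

/-- number of words -/
noncomputable def N (S : SmaleSpace X) (R1 : Set (Set X)) (m : ℕ) : ℕ := (W S R1 m).ncard

/-- representatives -/
noncomputable def rp (S : SmaleSpace X) (R1 : Set (Set X)) [Nonempty X] (m : ℕ) (w : ℤ → Set X) : X :=
  Function.invFunOn (wd S R1 m) (Gen S R1) w

section
variable {S : SmaleSpace X} {R1 : Set (Set X)} {e : ℝ} 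

lemma wd_apply {m : ℕ} {x : X} {i : ℤ} (h0 : 0 ≤ i) (h1 : i < m) :
    wd S R1 m x i = cd R1 (it S i x) := by simp [wd, h0, h1]

lemma wd_eq {m : ℕ} {x y : X} : wd S R1 m x = wd S R1 m y ↔ 
    ∀ i : ℤ, 0 ≤ i → i < m → cd R1 (it S i x) = cd R1 (it S i y) := by
  constructor
  · intro h i h0 h1
    rw [← wd_apply h0 h1, h, wd_apply h0 h1]
  · intro h
    funext i
    by_cases hi : 0 ≤ i ∧ i < m
    · rw [wd_apply hi.1 hi.2, wd_apply hi.1 hi.2, h i hi.1 hi.2]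
    · simp [wd, hi]

lemma wd_mem {m : ℕ} {x : X} (hx : x ∈ Gen S R1) : wd S R1 m x ∈ W S R1 m := ⟨x, hx, rfl⟩

lemma rp_mem [Nonempty X] {m : ℕ} {w : ℤ → Set X} (hw : w ∈ W S R1 m) : rp S R1 m w ∈ Gen S R1 :=
  Function.invFunOn_mem hw
lemma rp_eq [Nonempty X] {m : ℕ} {w : ℤ → Set X} (hw : w ∈ W S R1 m) : 
    wd S R1 m (rp S R1 m w) = w :=
  Function.invFunOn_eq hw

lemma rp_ext [Nonempty X] {m : ℕ} {w v : ℤ → Set X} (hw : w ∈ W S R1 m) (hv : v ∈ W S R1 m)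
    (h : ∀ i : ℤ, 0 ≤ i → i < m → cd R1 (it S i (rp S R1 m w)) = cd R1 (it S i (rp S R1 m v))) :
    w = v := by
  rw [← rp_eq hw, ← rp_eq hv]; exact wd_eq.2 h

/-- the representative of the word of `x` has the same letters -/
lemma rp_wd [Nonempty X] {m : ℕ} {x : X} (hx : x ∈ Gen S R1) (i : ℤ) (h0 : 0 ≤ i) (h1 : i < m) :
    cd R1 (it S i (rp S R1 m (wd S R1 m x))) = cd R1 (it S i x) :=
  wd_eq.1 (rp_eq (wd_mem hx)) i h0 h1

variable (hs : Setup S R1 e)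
include hs

lemma W_fin (m : ℕ) : (W S R1 m).Finite := by
  refine Set.Finite.of_finite_image (f := fun w (i : Fin m) => w (i : ℕ)) ?_ ?_
  · refine (Set.Finite.pi' (fun _ : Fin m => hs.fin)).subset ?_
    rintro _ ⟨_, ⟨x, hx, rfl⟩, rfl⟩ i
    simp only
    rw [wd_apply (by omega) (by exact_mod_cast i.2)]
    exact (gen_cd hx _).1
  · rintro _ ⟨x, hx, rfl⟩ _ ⟨y, hy, rfl⟩ h
    refine wd_eq.2 (fun i h0 h1 => ?_)
    obtain ⟨n, rfl⟩ := Int.eq_ofNat_of_zero_le h0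
    have := congrFun h ⟨n, by exact_mod_cast h1⟩
    simpa [wd_apply h0 h1] using this

lemma gen_ne [CompactSpace X] [Nonempty X] : (Gen S R1).Nonempty := (gen_dense hs).nonempty

lemma N_pos [CompactSpace X] [Nonempty X] (m : ℕ) : 0 < N S R1 m :=
  (Set.ncard_pos (W_fin hs m)).2 ((gen_ne hs).image _)

lemma N_zero [CompactSpace X] [Nonempty X] : N S R1 0 = 1 := by
  rw [N, Set.ncard_eq_one]
  obtain ⟨x, hx⟩ := gen_ne hs
  refine ⟨wd S R1 0 x, ?_⟩
  ext w; constructor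
  · rintro ⟨y, hy, rfl⟩
    exact wd_eq.2 (fun i h0 h1 => by simp at h1; omega)
  · rintro rfl; exact wd_mem hx

lemma N_sub [Nonempty X] (m k : ℕ) : N S R1 (m + k) ≤ N S R1 m * N S R1 k := by
  rw [N, N, N, ← Set.ncard_prod]
  refine Set.ncard_le_ncard_of_injOn (fun w => (wd S R1 m (rp S R1 (m + k) w), 
    wd S R1 k (it S m (rp S R1 (m + k) w)))) ?_ ?_ ((W_fin hs m).prod (W_fin hs k))
  · intro w hw
    exact ⟨wd_mem (rp_mem hw), wd_mem (gen_it (rp_mem hw) _)⟩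
  · intro w hw v hv h
    simp only [Prod.mk.injEq, wd_eq, it_add] at h
    refine rp_ext hw hv (fun i h0 h1 => ?_)
    by_cases hi : i < m
    · exact h.1 i h0 hi
    · have := h.2 (i - m) (by omega) (by push_cast at h1; omega)
      simpa using this

lemma ext_upper [Nonempty X] (a l b : ℕ) (x : X) :
    {w ∈ W S R1 (a + l + b) | ∀ i : ℤ, 0 ≤ i → i < l → 
      cd R1 (it S (a + i) (rp S R1 (a + l + b) w)) = cd R1 (it S i x)}.ncard ≤ N S R1 a * N S R1 b := by
  rw [N, N, ← Set.ncard_prod]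
  refine Set.ncard_le_ncard_of_injOn (fun w => (wd S R1 a (rp S R1 (a + l + b) w), 
    wd S R1 b (it S (a + l : ℕ) (rp S R1 (a + l + b) w)))) ?_ ?_ ((W_fin hs a).prod (W_fin hs b))
  · intro w hw
    exact ⟨wd_mem (rp_mem hw.1), wd_mem (gen_it (rp_mem hw.1) _)⟩
  · intro w hw v hv h
    simp only [Prod.mk.injEq, wd_eq, it_add] at h
    refine rp_ext hw.1 hv.1 (fun i h0 h1 => ?_)
    by_cases hi : i < a
    · exact h.1 i h0 hi
    · by_cases hi2 : i < a + l
      · have h2 := hw.2 (i - a) (by omega) (by omega)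
        have h3 := hv.2 (i - a) (by omega) (by omega)
        simp only [add_sub_cancel] at h2 h3
        rw [h2, h3]
      · have := h.2 (i - (a + l : ℕ)) (by push_cast; omega) (by push_cast at h1 ⊢; omega)
        simpa using this

/-- gluing property with gap `p` -/
def GlueP (S : SmaleSpace X) (R1 : Set (Set X)) (p : ℕ) : Prop :=
  ∀ (m k : ℕ) (x y : X), x ∈ Gen S R1 → y ∈ Gen S R1 →
    ∃ z ∈ Gen S R1, (∀ i : ℤ, -m ≤ i → i ≤ 0 → cd R1 (it S i z) = cd R1 (it S i x)) ∧
      (∀ i : ℤ, 0 ≤ i → i ≤ k → cd R1 (it S (p + i) z) = cd R1 (it S i y))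

omit hs in
lemma glue3 {p : ℕ} (hp : GlueP S R1 p) (a l b : ℕ) {y1 x y2 : X} (hy1 : y1 ∈ Gen S R1)
    (hx : x ∈ Gen S R1) (hy2 : y2 ∈ Gen S R1) : ∃ z ∈ Gen S R1, 
    (∀ i : ℤ, 0 ≤ i → i < a → cd R1 (it S i z) = cd R1 (it S i y1)) ∧ 
    (∀ i : ℤ, 0 ≤ i → i < l → cd R1 (it S ((a + p : ℕ) + i) z) = cd R1 (it S i x)) ∧ 
    (∀ i : ℤ, 0 ≤ i → i < b → cd R1 (it S ((a + p + l + p : ℕ) + i) z) = cd R1 (it S i y2)) := by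
  obtain ⟨z1, hz1, k1, k2⟩ := hp a l (it S a y1) x (gen_it hy1 _) hx
  obtain ⟨z2, hz2, k3, k4⟩ := hp (a + p + l) b (it S (p + l : ℕ) z1) y2 (gen_it hz1 _) hy2
  refine ⟨it S (-(a + p + l : ℕ)) z2, gen_it hz2 _, ?_, ?_, ?_⟩
  · intro i h0 h1
    have j1 := k1 (i - a) (by omega) (by omega)
    have j2 := k3 (i - (a + p + l : ℕ)) (by push_cast; omega) (by push_cast; omega)
    rw [it_add] at j1 j2 ⊢
    rw [← sub_eq_add_neg, j2]
    rw [show i - a + a = i by ring] at j1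
    rw [← j1]; congr 2; push_cast; ring
  · intro i h0 h1
    have j1 := k2 i h0 h1.le
    have j2 := k3 (i - l) (by push_cast; omega) (by push_cast; omega)
    rw [it_add] at j2 ⊢
    rw [show ((a + p : ℕ) : ℤ) + i + -(a + p + l : ℕ) = i - l by push_cast; ring, j2, ← j1]
    congr 2; push_cast; ring
  · intro i h0 h1
    have j1 := k4 i h0 h1.le
    rw [it_add, ← j1]
    congr 2; push_cast; ring

lemma ext_lower [Nonempty X] {p : ℕ} (hp : GlueP S R1 p) (a l b : ℕ) {x : X} (hx : x ∈ Gen S R1) :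
    N S R1 a * N S R1 b ≤ {w ∈ W S R1 ((a + p) + l + (p + b)) | ∀ i : ℤ, 0 ≤ i → i < l → 
      cd R1 (it S ((a + p : ℕ) + i) (rp S R1 ((a + p) + l + (p + b)) w)) = cd R1 (it S i x)}.ncard := by
  rw [N, N, ← Set.ncard_prod]
  have : ∀ v : (ℤ → Set X) × (ℤ → Set X), ∃ z, v ∈ W S R1 a ×ˢ W S R1 b → z ∈ Gen S R1 ∧  
    (∀ i : ℤ, 0 ≤ i → i < a → cd R1 (it S i z) = cd R1 (it S i (rp S R1 a v.1))) ∧ 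
    (∀ i : ℤ, 0 ≤ i → i < l → cd R1 (it S ((a + p : ℕ) + i) z) = cd R1 (it S i x)) ∧ 
    (∀ i : ℤ, 0 ≤ i → i < b → cd R1 (it S ((a + p + l + p : ℕ) + i) z) = cd R1 (it S i (rp S R1 b v.2))) := by
    intro v
    by_cases hv : v ∈ W S R1 a ×ˢ W S R1 b
    · obtain ⟨z, h⟩ := glue3 hp a l b (rp_mem hv.1) hx (rp_mem hv.2)
      exact ⟨z, fun _ => h⟩
    · exact ⟨x, fun h => absurd h hv⟩
  choose z hz using this
  refine Set.ncard_le_ncard_of_injOn (fun v => wd S R1 ((a + p) + l + (p + b)) (z v)) ?_ ?_ ((W_fin hs _).subset (sep_subset _ _))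
  · intro v hv
    refine ⟨wd_mem (hz v hv).1, fun i h0 h1 => ?_⟩
    rw [rp_wd (hz v hv).1 _ (by omega) (by push_cast; omega)]
    exact (hz v hv).2.2.1 i h0 h1
  · intro v hv u hu h
    simp only [wd_eq] at h
    refine Prod.ext (rp_ext hv.1 hu.1 (fun i h0 h1 => ?_)) (rp_ext hv.2 hu.2 (fun i h0 h1 => ?_))
    · rw [← (hz v hv).2.1 i h0 h1, ← (hz u hu).2.1 i h0 h1]
      exact h i h0 (by push_cast; omega)
    · rw [← (hz v hv).2.2.2 i h0 h1, ← (hz u hu).2.2.2 i h0 h1]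
      exact h _ (by omega) (by push_cast; omega)

lemma N_super [CompactSpace X] [Nonempty X] {p : ℕ} (hp : GlueP S R1 p) (m k : ℕ) : 
    N S R1 m * N S R1 k ≤ N S R1 (m + k) * N S R1 (2 * p) := by
  obtain ⟨x, hx⟩ := gen_ne hs
  refine (ext_lower hs hp m 0 k hx).trans ?_
  refine (Set.ncard_le_ncard (sep_subset _ _) (W_fin hs _)).trans ?_
  refine le_trans (le_of_eq ?_) (N_sub hs (m + k) (2 * p))
  rw [N]; congr 2; ring

lemma N_growth [CompactSpace X] [Nonempty X] : ∃ l C : ℝ, 0 ≤ l ∧ 1 ≤ C ∧ 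
    ∀ m : ℕ, Real.exp (l * m) ≤ N S R1 m ∧ (N S R1 m : ℝ) ≤ C * Real.exp (l * m) := by
  obtain ⟨p, hp⟩ := glue hs
  have hp : GlueP S R1 p := hp
  have pos : ∀ m, (1:ℝ) ≤ N S R1 m := fun m => by exact_mod_cast N_pos hs m
  set v : ℕ → ℝ := fun m => Real.log (N S R1 m) with hv
  have v0 : ∀ m, 0 ≤ v m := fun m => Real.log_nonneg (pos m)
  have vs : ∀ m k, v (m + k) ≤ v m + v k := by
    intro m k
    rw [hv]; simp only
    rw [← Real.log_mul (by linarith [pos m]) (by linarith [pos k])]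
    exact Real.log_le_log (by linarith [pos (m + k)]) (by exact_mod_cast N_sub hs m k)
  have vt : ∀ m k, v m + v k ≤ v (m + k) + v (2 * p) := by
    intro m k
    rw [hv]; simp only
    rw [← Real.log_mul (by linarith [pos m]) (by linarith [pos k]), 
      ← Real.log_mul (by linarith [pos (m + k)]) (by linarith [pos (2 * p)])]
    exact Real.log_le_log (mul_pos (by linarith [pos m]) (by linarith [pos k])) 
      (by exact_mod_cast N_super hs hp m k)
  have s1 : Subadditive v := vs
  have s2 : Subadditive (fun m => v (2 * p) - v m) := by
    intro m k; simp only; linarith [vt m k]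
  have b1 : BddBelow (range fun n => v n / n) := ⟨0, by 
    rintro _ ⟨n, rfl⟩; exact div_nonneg (v0 n) (by positivity)⟩
  have vlin : ∀ n : ℕ, v n ≤ n * v 1 := by
    intro n
    induction n with
    | zero => simp [hv, N_zero hs]
    | succ n ih => push_cast; linarith [vs n 1]
  have b2 : BddBelow (range fun n : ℕ => (v (2 * p) - v n) / n) := ⟨- v 1, by 
    rintro _ ⟨n, rfl⟩
    rcases Nat.eq_zero_or_pos n with h | h
    · subst h; simp [v0 1]
    · have hn : (0:ℝ) < n := by exact_mod_cast h
      simp only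
      rw [le_div_iff₀ hn]; linarith [vlin n, v0 (2 * p)]⟩
  have t1 := s1.tendsto_lim b1
  have t2 := s2.tendsto_lim b2
  have t3 : Filter.Tendsto (fun n : ℕ => (v (2 * p) - v n) / n) Filter.atTop (𝓝 (0 - s1.lim)) := by
    refine ((tendsto_const_div_atTop_nhds_zero_nat (v (2 * p))).sub t1).congr (fun n => ?_)
    rw [sub_div]
  have hl := tendsto_nhds_unique t2 t3
  set l := s1.lim with hl'
  have hl0 : 0 ≤ l := ge_of_tendsto' t1 (fun n => div_nonneg (v0 n) (by positivity))
  refine ⟨l, N S R1 (2 * p), hl0, pos _, fun m => ?_⟩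
  rcases Nat.eq_zero_or_pos m with h | h
  · subst h; simp [N_zero hs]; exact N_pos hs _
  have hm : (0:ℝ) < m := by exact_mod_cast h
  constructor
  · have := s1.lim_le_div b1 h.ne'
    rw [← hl', le_div_iff₀ hm] at this
    rw [← Real.le_log_iff_exp_le (by linarith [pos m])]
    exact this
  · have := s2.lim_le_div b2 h.ne'
    rw [hl, le_div_iff₀ hm] at this
    have h3 : v m ≤ v (2 * p) + l * m := by linarith
    rw [hv] at h3; simp only at h3
    rw [Real.log_le_iff_le_exp (by linarith [pos m]), Real.exp_add, Real.exp_log (by linarith [pos (2 * p)])] at h3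
    exact h3
end
end SB

open Set Metric MeasureTheory Topology
open scoped ENNReal NNReal
namespace SB
variable {X : Type*} [MetricSpace X]
section
variable {S : SmaleSpace X} {R1 : Set (Set X)} {e : ℝ} 
variable (hs : Setup S R1 e)
include hs

lemma cov_upper [CompactSpace X] [Nonempty X] (k n : ℕ) (δ : ℝ) (hk : S.lam⁻¹ ^ k * e < δ)
    {U : Set (X × X)} (hU : ∀ a b : X, dist a b < δ → (a, b) ∈ U) :
    Dynamics.coverMincard (⇑S.phi) (Gen S R1) U n ≤ (N S R1 (n + 2 * k) : ℕ∞) := by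
  classical
  set s : Finset X := (W_fin hs (n + 2 * k)).toFinset.image (fun w => it S k (rp S R1 (n + 2 * k) w))
    with hsd
  have hc : Dynamics.IsDynCoverOf (⇑S.phi) (Gen S R1) U n (s : Set X) := by
    intro x hx
    have hx' := gen_it hx (-(k:ℤ))
    refine ⟨it S k (rp S R1 (n + 2 * k) (wd S R1 (n + 2 * k) (it S (-(k:ℤ)) x))), ?_, ?_⟩
    · rw [hsd, Finset.mem_coe, Finset.mem_image]
      exact ⟨_, (W_fin hs _).mem_toFinset.2 (wd_mem hx'), rfl⟩
    · rw [Dynamics.mem_dynEntourage]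
      intro j hj
      apply hU
      refine lt_of_le_of_lt ?_ hk
      rw [mul_comm (S.lam⁻¹ ^ k), ← it_nat, ← it_nat]
      refine diam_upper hs k (fun i h1 h2 => ⟨cd R1 (it S i (it S j x)), ?_, ?_, ?_⟩)
      · rw [it_add]; exact (gen_cd hx _).1
      · rw [it_add]; exact interior_subset (gen_cd hx _).2
      · have := rp_wd (m := n + 2 * k) hx' (i + (j + k)) (by omega) (by push_cast; omega)
        rw [it_add S _ (-(k:ℤ))] at this
        have e1 : i + ((j:ℤ) + k) + -(k:ℤ) = i + j := by ring
        rw [e1] at this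
        rw [it_add, it_add, it_add, ← this, add_assoc]
        exact interior_subset (gen_cd (rp_mem (wd_mem hx')) _).2
  refine hc.coverMincard_le_card.trans ?_
  have : s.card ≤ N S R1 (n + 2 * k) := by
    refine Finset.card_image_le.trans ?_
    rw [N, Set.ncard_eq_toFinset_card _ (W_fin hs _)]
  exact_mod_cast this

lemma cov_lower [CompactSpace X] [Nonempty X] (n : ℕ) :
    (N S R1 (n + 1) : ℕ∞) ≤ (R1.ncard * R1.ncard : ℕ) * 
      Dynamics.coverMincard (⇑S.phi) univ {p : X × X | dist p.1 p.2 < S.eps / 2} (n + 1) := by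
  classical
  set U := {p : X × X | dist p.1 p.2 < S.eps / 2} with hU
  obtain ⟨s, hc, hcard⟩ : ∃ s : Finset X, Dynamics.IsDynCoverOf (⇑S.phi) univ U (n+1) (s : Set X) ∧ 
      (s.card : ℕ∞) = Dynamics.coverMincard (⇑S.phi) univ U (n + 1) := by
    have h1 : U ∈ uniformity X := Metric.dist_mem_uniformity (by linarith [S.eps_pos])
    have := Dynamics.coverMincard_finite_of_isCompact_uniformContinuous isCompact_univ
      (CompactSpace.uniformContinuous_of_continuous S.phi_cont) h1 (n+1)
    exact Dynamics.coverMincard_finite_iff _ _ _ _ |>.1 this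
  rw [← hcard]
  choose f hf hf2 using fun x => hc (mem_univ x)
  have : N S R1 (n+1) ≤ R1.ncard * R1.ncard * s.card := by
    rw [N, ← Set.ncard_coe_finset s, ← Set.ncard_prod, ← Set.ncard_prod]
    refine Set.ncard_le_ncard_of_injOn (fun w => ((cd R1 (it S 0 (rp S R1 (n+1) w)), 
      cd R1 (it S n (rp S R1 (n+1) w))), f (rp S R1 (n+1) w))) ?_ ?_ 
      ((hs.fin.prod hs.fin).prod s.finite_toSet)
    · intro w hw
      exact ⟨⟨(gen_cd (rp_mem hw) _).1, (gen_cd (rp_mem hw) _).1⟩, hf _⟩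
    · intro w hw v hv h
      simp only [Prod.mk.injEq] at h
      obtain ⟨⟨h1, h2⟩, h3⟩ := h
      apply rp_ext hw hv
      rw [it_zero, it_zero] at h1
      intro i i0 i1
      refine code_inj hs n (rp_mem hw) (rp_mem hv) h1 h2 ?_ i i0 (by push_cast at i1; omega)
      intro j j0 j1
      lift j to ℕ using j0
      have k1 := Dynamics.mem_dynEntourage.1 (hf2 (rp S R1 (n+1) w)) j (by omega)
      have k2 := Dynamics.mem_dynEntourage.1 (hf2 (rp S R1 (n+1) v)) j (by omega)
      rw [← h3] at k2
      simp only [hU, mem_setOf_eq] at k1 k2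
      rw [it_nat, it_nat]
      linarith [dist_triangle_right ((⇑S.phi)^[j] (rp S R1 (n+1) w)) ((⇑S.phi)^[j] (rp S R1 (n+1) v)) 
        ((⇑S.phi)^[j] (f (rp S R1 (n+1) w)))]
  exact_mod_cast this

lemma exp_cast (l : ℝ) (n : ℕ) : EReal.exp ((l : EReal) * (n : EReal)) = ENNReal.ofReal (Real.exp (l * n)) := by
  rw [← EReal.exp_coe]; push_cast; rfl

lemma entropy_eq [CompactSpace X] [Nonempty X] {l C : ℝ} (hl : 0 ≤ l) (hC : 1 ≤ C) 
    (hN : ∀ m : ℕ, Real.exp (l * m) ≤ N S R1 m ∧ (N S R1 m : ℝ) ≤ C * Real.exp (l * m)) :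
    Dynamics.coverEntropy (⇑S.phi) univ = (l : EReal) := by
  apply le_antisymm
  · rw [← (gen_dense hs).closure_eq, 
      Dynamics.coverEntropy_closure S.phi_cont, Dynamics.coverEntropy]
    refine iSup₂_le (fun U hU => ?_)
    obtain ⟨δ, hδ, hU⟩ := Metric.mem_uniformity_dist.1 hU
    obtain ⟨k, hk⟩ := exists_pow_small hs (half_pos hδ)
    have hk := hk k le_rfl
    rw [Dynamics.coverEntropyEntourage, ← ExpGrowth.expGrowthSup_exp (a := (l : EReal))]
    refine ExpGrowth.expGrowthSup_le_of_eventually_le (b := ENNReal.ofReal (C * Real.exp (l * (2 * k)))) 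
      ENNReal.ofReal_ne_top (Filter.Eventually.of_forall fun n => ?_)
    have h1 := cov_upper hs k n δ (by linarith) (U := U) (fun a b h => hU h)
    have h2 : ((Dynamics.coverMincard (⇑S.phi) (Gen S R1) U n : ℕ∞) : ℝ≥0∞) ≤ 
      (N S R1 (n + 2 * k) : ℝ≥0∞) := by
      have := ENat.toENNReal_le.2 h1
      simpa using this
    refine h2.trans ?_
    rw [exp_cast hs, ← ENNReal.ofReal_mul (by positivity), ← ENNReal.ofReal_natCast]
    apply ENNReal.ofReal_le_ofReal
    refine (hN _).2.trans (le_of_eq ?_)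
    rw [mul_assoc, ← Real.exp_add]; push_cast; ring_nf
  · have h1 : {p : X × X | dist p.1 p.2 < S.eps / 2} ∈ uniformity X := 
      Metric.dist_mem_uniformity (by linarith [S.eps_pos])
    refine le_trans ?_ (Dynamics.coverEntropyEntourage_le_coverEntropy _ _ h1)
    rw [Dynamics.coverEntropyEntourage]
    conv_lhs => rw [← ExpGrowth.expGrowthSup_exp (a := (l : EReal))]
    have hR : (0:ℝ) < R1.ncard * R1.ncard := by
      obtain ⟨x⟩ := ‹Nonempty X›
      obtain ⟨R, hR, _⟩ := hs.cov x
      have : 0 < R1.ncard := (Set.ncard_pos hs.fin).2 ⟨R, hR⟩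
      positivity
    refine ExpGrowth.expGrowthSup_le_of_eventually_le (b := ((R1.ncard * R1.ncard : ℕ) : ℝ≥0∞)) 
      (ENNReal.natCast_ne_top _) ?_
    filter_upwards [Filter.eventually_ge_atTop 1] with n hn
    obtain ⟨n, rfl⟩ : ∃ k, n = k + 1 := ⟨n - 1, by omega⟩
    have h2 := ENat.toENNReal_le.2 (cov_lower hs n)
    rw [ENat.toENNReal_mul] at h2
    rw [exp_cast hs]
    refine le_trans ?_ h2
    rw [ENat.toENNReal_coe, ← ENNReal.ofReal_natCast]
    exact ENNReal.ofReal_le_ofReal (hN _).1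
end
end SB

open Set Metric MeasureTheory Topology
open scoped ENNReal NNReal
namespace SB
variable {X : Type*} [MetricSpace X]

/-- empirical measure -/
noncomputable def emp {ι : Type*} [MeasurableSpace X] (T : X → X) (A : Finset ι) (y : ι → X) (q : ℕ) : Measure X :=
  (ENNReal.ofReal (A.card * (q + 1) : ℝ)⁻¹) • ∑ j ∈ Finset.range (q + 1), ∑ w ∈ A, Measure.dirac (T^[j] (y w))

section
variable {ι : Type*} [MeasurableSpace X] [BorelSpace X] {T : X → X} {A : Finset ι} {y : ι → X} {q : ℕ}

open Classical in
lemma emp_apply {F : Set X} (hF : MeasurableSet F) : emp T A y q F = 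
    ENNReal.ofReal ((A.card * (q + 1) : ℝ)⁻¹ * ∑ j ∈ Finset.range (q + 1), ((A.filter (fun w => T^[j] (y w) ∈ F)).card : ℝ)) := by
  rw [emp, Measure.smul_apply, Measure.finset_sum_apply, smul_eq_mul, ENNReal.ofReal_mul (by positivity), 
    ENNReal.ofReal_sum_of_nonneg (fun _ _ => by positivity)]
  congr 1
  refine Finset.sum_congr rfl (fun j _ => ?_)
  rw [Measure.finset_sum_apply, ENNReal.ofReal_natCast, Finset.card_filter]
  push_cast
  refine Finset.sum_congr rfl (fun w _ => ?_)
  rw [Measure.dirac_apply' _ hF, Set.indicator_apply]; simp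

lemma emp_prob (hA : A.Nonempty) : IsProbabilityMeasure (emp T A y q) := by
  constructor
  have : (0:ℝ) < A.card := by exact_mod_cast hA.card_pos
  rw [emp_apply MeasurableSet.univ]
  simp
  field_simp

lemma emp_integral (f : X → ℝ) : ∫ x, f x ∂(emp T A y q) = 
    (A.card * (q + 1) : ℝ)⁻¹ * ∑ j ∈ Finset.range (q + 1), ∑ w ∈ A, f (T^[j] (y w)) := by
  have hi : ∀ z : X, Integrable f (Measure.dirac z) := fun z => integrable_dirac (by simp)
  rw [emp, integral_smul_measure, ENNReal.toReal_ofReal (by positivity), smul_eq_mul, 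
    integral_finset_sum_measure]
  · congr 1
    refine Finset.sum_congr rfl (fun j _ => ?_)
    rw [integral_finset_sum_measure (fun w _ => hi _)]
    refine Finset.sum_congr rfl (fun w _ => ?_)
    rw [integral_dirac]
  · intro j _
    exact integrable_finset_sum_measure.2 (fun w _ => hi _)

lemma emp_inv (hA : A.Nonempty) (f : X → ℝ) (B : ℝ) (hB : ∀ x, |f x| ≤ B) : 
    |∫ x, f (T x) ∂(emp T A y q) - ∫ x, f x ∂(emp T A y q)| ≤ 2 * B * (1 / ((q : ℝ) + 1)) := by
  have hc : (0:ℝ) < A.card := by exact_mod_cast hA.card_pos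
  rw [emp_integral, emp_integral, ← mul_sub, ← Finset.sum_sub_distrib]
  have : ∑ j ∈ Finset.range (q + 1), (∑ w ∈ A, f (T (T^[j] (y w))) - ∑ w ∈ A, f (T^[j] (y w))) =
     ∑ w ∈ A, (f (T^[q+1] (y w)) - f (y w)) := by
    simp only [← Function.iterate_succ_apply' T]
    rw [Finset.sum_range_sub (fun j => ∑ w ∈ A, f (T^[j] (y w))), ← Finset.sum_sub_distrib]
    simp
  rw [this, abs_mul, abs_of_pos (by positivity : (0:ℝ) < (A.card * (q + 1) : ℝ)⁻¹)]
  have h2 : |∑ w ∈ A, (f (T^[q+1] (y w)) - f (y w))| ≤ A.card * (2 * B) := by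
    refine (Finset.abs_sum_le_sum_abs _ _).trans ?_
    rw [← nsmul_eq_mul]
    refine Finset.sum_le_card_nsmul _ _ _ (fun w _ => ?_)
    have := abs_sub (f (T^[q+1] (y w))) (f (y w))
    linarith [hB (T^[q+1] (y w)), hB (y w)]
  refine (mul_le_mul_of_nonneg_left h2 (by positivity)).trans (le_of_eq ?_)
  field_simp

open Classical in
lemma exists_lim [CompactSpace X] (hT : Continuous T) (A : ℕ → Finset ι) (y : ℕ → ι → X) (hA : ∀ q, (A q).Nonempty) :
    ∃ μ : Measure X, IsProbabilityMeasure μ ∧ MeasurePreserving T μ μ ∧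
     (∀ F : Set X, IsClosed F → ∀ c : ℝ, (∀ᶠ q in Filter.atTop, ∀ j ≤ q, 
        c * (A q).card ≤ ((A q).filter (fun w => T^[j] (y q w) ∈ F)).card) → ENNReal.ofReal c ≤ μ F) ∧ 
     (∀ F : Set X, IsOpen F → ∀ c : ℝ, (∀ᶠ q in Filter.atTop, ∀ j ≤ q, 
        (((A q).filter (fun w => T^[j] (y q w) ∈ F)).card : ℝ) ≤ c * (A q).card) → μ F ≤ ENNReal.ofReal c) := by
  set ν : ℕ → ProbabilityMeasure X := fun q => ⟨emp T (A q) (y q) q, emp_prob (hA q)⟩ with hν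
  set L : Ultrafilter ℕ := Filter.hyperfilter ℕ with hL
  have hLle : (L : Filter ℕ) ≤ Filter.atTop := by
    rw [← Nat.cofinite_eq_atTop]; exact Filter.hyperfilter_le_cofinite
  obtain ⟨μ, -, hμ⟩ := isCompact_univ.ultrafilter_le_nhds (L.map ν) (by simp)
  have hlim : Filter.Tendsto ν L (𝓝 μ) := hμ
  have hcard : ∀ q, (0:ℝ) < (A q).card := fun q => by exact_mod_cast (hA q).card_pos
  refine ⟨μ, inferInstance, ⟨hT.measurable, ?_⟩, ?_, ?_⟩
  · haveI : IsProbabilityMeasure (Measure.map T (μ : Measure X)) := 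
      Measure.isProbabilityMeasure_map hT.measurable.aemeasurable
    refine ext_of_forall_integral_eq_of_IsFiniteMeasure (fun f => ?_)
    rw [integral_map hT.measurable.aemeasurable f.continuous.aestronglyMeasurable]
    have t1 := ProbabilityMeasure.tendsto_iff_forall_integral_tendsto.1 hlim f
    have t2 := ProbabilityMeasure.tendsto_iff_forall_integral_tendsto.1 hlim (f.compContinuous ⟨T, hT⟩)
    have t3 := t2.sub t1
    have t4 : Filter.Tendsto (fun q : ℕ => 2 * ‖f‖ * (1 / ((q : ℝ) + 1))) L (𝓝 (2 * ‖f‖ * 0)) :=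
      (tendsto_one_div_add_atTop_nhds_zero_nat.const_mul _).mono_left hLle
    rw [mul_zero] at t4
    have t5 : Filter.Tendsto (fun q => ∫ x, f.compContinuous ⟨T, hT⟩ x ∂(ν q : Measure X) - 
      ∫ x, f x ∂(ν q : Measure X)) L (𝓝 0) := by
      refine squeeze_zero_norm (fun q => ?_) t4
      exact emp_inv (hA q) f ‖f‖ (fun x => f.norm_coe_le_norm x)
    have := tendsto_nhds_unique t3 t5
    exact sub_eq_zero.1 this
  · intro F hF c hc
    refine le_trans ?_ (ProbabilityMeasure.limsup_measure_closed_le_of_tendsto hlim hF)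
    refine Filter.le_limsup_of_frequently_le' (Filter.Eventually.frequently ?_)
    filter_upwards [hc.filter_mono hLle] with q hq
    show _ ≤ emp T (A q) (y q) q F
    rw [emp_apply hF.measurableSet]
    apply ENNReal.ofReal_le_ofReal
    have h1 : ((q+1 : ℕ) : ℝ) * (c * (A q).card) ≤ ∑ j ∈ Finset.range (q + 1), (((A q).filter (fun w => T^[j] (y q w) ∈ F)).card : ℝ) := by
      rw [← nsmul_eq_mul]
      conv_lhs => rw [← Finset.card_range (q+1)]
      exact Finset.card_nsmul_le_sum _ _ _ (fun j hj => hq j (by simpa [Nat.lt_succ_iff] using hj))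
    have := hcard q
    rw [inv_mul_eq_div, le_div_iff₀ (by positivity)]
    push_cast at h1; linarith
  · intro F hF c hc
    refine le_trans (ProbabilityMeasure.le_liminf_measure_open_of_tendsto hlim hF) ?_
    refine Filter.liminf_le_of_frequently_le' (Filter.Eventually.frequently ?_)
    filter_upwards [hc.filter_mono hLle] with q hq
    show emp T (A q) (y q) q F ≤ _ 
    rw [emp_apply hF.measurableSet]
    apply ENNReal.ofReal_le_ofReal
    have h1 : ∑ j ∈ Finset.range (q + 1), (((A q).filter (fun w => T^[j] (y q w) ∈ F)).card : ℝ) ≤ ((q+1 : ℕ) : ℝ) * (c * (A q).card) := by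
      rw [← nsmul_eq_mul]
      conv_rhs => rw [← Finset.card_range (q+1)]
      exact Finset.sum_le_card_nsmul _ _ _ (fun j hj => hq j (by simpa [Nat.lt_succ_iff] using hj))
    have := hcard q
    rw [inv_mul_eq_div, div_le_iff₀ (by positivity)]
    push_cast at h1; linarith
end
end SB

open Set Metric MeasureTheory Topology
open scoped ENNReal NNReal
namespace SB
variable {X : Type*} [MetricSpace X]

/-- the symmetric rectangle of a generic point -/
def Rc (S : SmaleSpace X) (R1 : Set (Set X)) (k : ℕ) (x : X) : Set X := 
  {z | ∀ i : ℤ, -k ≤ i → i ≤ k → it S i z ∈ cd R1 (it S i x)}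

section
variable {S : SmaleSpace X} {R1 : Set (Set X)} {e : ℝ} 

lemma Rc_self {k : ℕ} {x : X} (hx : x ∈ Gen S R1) : x ∈ Rc S R1 k x := 
  fun i _ _ => interior_subset (gen_cd hx i).2

variable (hs : Setup S R1 e)
include hs

lemma Rc_closed {k : ℕ} {x : X} (hx : x ∈ Gen S R1) : IsClosed (Rc S R1 k x) := by
  have : Rc S R1 k x = ⋂ i : ℤ, ⋂ (_ : -k ≤ i), ⋂ (_ : i ≤ k), (it S i) ⁻¹' (cd R1 (it S i x)) := by
    ext z; simp [Rc]
  rw [this]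
  exact isClosed_iInter fun i => isClosed_iInter fun _ => isClosed_iInter fun _ => 
    (hs.closed _ (gen_cd hx i).1).preimage (it_cont S i)

/-- words whose symmetric rectangle touches that of `x` -/
lemma touch_card [Nonempty X] (k : ℕ) {x : X} (hx : x ∈ Gen S R1) : 
    {v ∈ W S R1 (2 * k + 1) | (Rc S R1 k (it S k (rp S R1 (2 * k + 1) v)) ∩ Rc S R1 k x).Nonempty}.ncard
      ≤ R1.ncard * R1.ncard := by
  rw [← Set.ncard_prod]
  refine Set.ncard_le_ncard_of_injOn (fun w => (cd R1 (it S 0 (rp S R1 (2 * k + 1) w)), 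
      cd R1 (it S (2 * k : ℕ) (rp S R1 (2 * k + 1) w)))) ?_ ?_ (hs.fin.prod hs.fin)
  · intro w hw
    exact ⟨(gen_cd (rp_mem hw.1) _).1, (gen_cd (rp_mem hw.1) _).1⟩
  · rintro w ⟨hw, t, ht1, ht2⟩ v ⟨hv, u, hu1, hu2⟩ h
    simp only [Prod.mk.injEq] at h
    obtain ⟨h1, h2⟩ := h
    apply rp_ext hw hv
    rw [it_zero, it_zero] at h1
    intro i i0 i1
    refine code_inj hs (2 * k) (rp_mem hw) (rp_mem hv) h1 h2 ?_ i i0 (by push_cast at i1 ⊢; omega)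
    intro j j0 j1
    push_cast at j1
    have key : ∀ v ∈ W S R1 (2 * k + 1), ∀ t ∈ Rc S R1 k (it S k (rp S R1 (2 * k + 1) v)), t ∈ Rc S R1 k x → 
        dist (it S j (rp S R1 (2 * k + 1) v)) (it S (j - k) x) ≤ e := by
      intro v hv t ht1 ht2
      have a1 := ht1 (j - k) (by omega) (by omega)
      have a2 := ht2 (j - k) (by omega) (by omega)
      rw [it_add, sub_add_cancel] at a1
      have b1 := hs.dle _ (gen_cd (rp_mem hv) j).1 _ (interior_subset (gen_cd (rp_mem hv) j).2) _ a1
      have b2 := hs.dle _ (gen_cd hx (j - k)).1 _ a2 _ (interior_subset (gen_cd hx (j - k)).2)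
      linarith [dist_triangle (it S j (rp S R1 (2 * k + 1) v)) (it S (j - k) t) (it S (j - k) x)]
    have c1 := key w hw t ht1 ht2
    have c2 := key v hv u hu1 hu2
    linarith [dist_triangle_right (it S j (rp S R1 (2 * k + 1) w)) (it S j (rp S R1 (2 * k + 1) v)) 
      (it S (j - k) x), hs.e_lt, hs.e_pos]

variable {l C : ℝ} (hC : 1 ≤ C) 
    (hN : ∀ m : ℕ, Real.exp (l * m) ≤ N S R1 m ∧ (N S R1 m : ℝ) ≤ C * Real.exp (l * m))
include hC hN

open Classical in
lemma cnt_upper [CompactSpace X] [Nonempty X] (q j k : ℕ) (hj : j ≤ q) (hk : k ≤ q) {x : X} :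
   (((W_fin hs (3 * q + 1)).toFinset.filter (fun w => ∀ i : ℤ, -k ≤ i → i ≤ k → 
      cd R1 (it S (q + j + i) (rp S R1 (3 * q + 1) w)) = cd R1 (it S i x))).card : ℝ) 
      ≤ C ^ 2 * Real.exp (-(l * (2 * k + 1))) * N S R1 (3 * q + 1) := by
  obtain ⟨a, ha⟩ : ∃ a, q + j = a + k := ⟨q + j - k, by omega⟩
  obtain ⟨b, hb⟩ : ∃ b, 2 * q = b + j + k := ⟨2 * q - j - k, by omega⟩
  have hM : 3 * q + 1 = a + (2 * k + 1) + b := by omega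
  have h1 := ext_upper hs a (2 * k + 1) b (it S (-(k:ℤ)) x)
  rw [← hM] at h1
  rw [Set.ncard_eq_toFinset_card _ ((W_fin hs _).subset (sep_subset _ _))] at h1
  have h2 : ((W_fin hs (3 * q + 1)).toFinset.filter (fun w => ∀ i : ℤ, -k ≤ i → i ≤ k → 
      cd R1 (it S (q + j + i) (rp S R1 (3 * q + 1) w)) = cd R1 (it S i x))).card ≤ N S R1 a * N S R1 b := by
    refine le_trans (Finset.card_le_card ?_) h1
    intro w hw
    rw [Finset.mem_filter, Set.Finite.mem_toFinset] at hw
    rw [Set.Finite.mem_toFinset]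
    refine ⟨hw.1, fun i i0 i1 => ?_⟩
    have := hw.2 (i - k) (by omega) (by push_cast at i1; omega)
    rw [it_add, ← sub_eq_add_neg, ← this]
    congr 2; omega
  have h3 : (((W_fin hs (3 * q + 1)).toFinset.filter (fun w => ∀ i : ℤ, -k ≤ i → i ≤ k → 
      cd R1 (it S (q + j + i) (rp S R1 (3 * q + 1) w)) = cd R1 (it S i x))).card : ℝ) ≤ N S R1 a * N S R1 b := by
    exact_mod_cast h2
  refine h3.trans ?_
  have h4 := mul_le_mul (hN a).2 (hN b).2 (by positivity) (by positivity)
  refine h4.trans ?_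
  have h5 := (hN (3 * q + 1)).1
  have h6 : (C * Real.exp (l * a)) * (C * Real.exp (l * b)) = 
    C ^ 2 * Real.exp (-(l * (2 * k + 1))) * Real.exp (l * (3 * q + 1 : ℕ)) := by
    have : (C * Real.exp (l * a)) * (C * Real.exp (l * b)) = C ^ 2 * (Real.exp (l * a) * Real.exp (l * b)) := by ring
    rw [this, mul_assoc, ← Real.exp_add, ← Real.exp_add, hM]
    push_cast; ring_nf
  rw [h6]
  exact mul_le_mul_of_nonneg_left h5 (by positivity)

open Classical in
lemma cnt_lower [CompactSpace X] [Nonempty X] {p : ℕ} (hp : GlueP S R1 p) (q j k : ℕ) (hj : j ≤ q) (hk : k + p ≤ q) {x : X} (hx : x ∈ Gen S R1) :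
    C⁻¹ * Real.exp (-(l * (2 * p + (2 * k + 1)))) * N S R1 (3 * q + 1) ≤ 
   (((W_fin hs (3 * q + 1)).toFinset.filter (fun w => ∀ i : ℤ, -k ≤ i → i ≤ k → 
      cd R1 (it S (q + j + i) (rp S R1 (3 * q + 1) w)) = cd R1 (it S i x))).card : ℝ) := by
  obtain ⟨a, ha⟩ : ∃ a, q + j = a + k + p := ⟨q + j - k - p, by omega⟩
  obtain ⟨b, hb⟩ : ∃ b, 2 * q = b + j + k + p := ⟨2 * q - j - k - p, by omega⟩
  have hM : 3 * q + 1 = (a + p) + (2 * k + 1) + (p + b) := by omega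
  have h1 := ext_lower hs hp a (2 * k + 1) b (gen_it hx (-(k:ℤ)))
  rw [← hM] at h1
  rw [Set.ncard_eq_toFinset_card _ ((W_fin hs _).subset (sep_subset _ _))] at h1
  have h2 : N S R1 a * N S R1 b ≤ ((W_fin hs (3 * q + 1)).toFinset.filter (fun w => ∀ i : ℤ, -k ≤ i → i ≤ k → 
      cd R1 (it S (q + j + i) (rp S R1 (3 * q + 1) w)) = cd R1 (it S i x))).card := by
    refine le_trans h1 (Finset.card_le_card ?_)
    intro w hw
    rw [Set.Finite.mem_toFinset] at hw
    rw [Finset.mem_filter, Set.Finite.mem_toFinset]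
    refine ⟨hw.1, fun i i0 i1 => ?_⟩
    have := hw.2 (i + k) (by omega) (by push_cast; omega)
    rw [it_add, add_neg_cancel_right] at this
    rw [← this]
    congr 2; push_cast; omega
  have h3 : (N S R1 a * N S R1 b : ℝ) ≤ (((W_fin hs (3 * q + 1)).toFinset.filter (fun w => ∀ i : ℤ, -k ≤ i → i ≤ k → 
      cd R1 (it S (q + j + i) (rp S R1 (3 * q + 1) w)) = cd R1 (it S i x))).card : ℝ) := by
    exact_mod_cast h2
  refine le_trans ?_ h3
  have h4 := mul_le_mul (hN a).1 (hN b).1 (by positivity) (by positivity)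
  refine le_trans ?_ h4
  have h5 := (hN (3 * q + 1)).2
  have h6 : Real.exp (l * a) * Real.exp (l * b) = 
    C⁻¹ * Real.exp (-(l * (2 * p + (2 * k + 1)))) * (C * Real.exp (l * (3 * q + 1 : ℕ))) := by
    have : C⁻¹ * Real.exp (-(l * (2 * p + (2 * k + 1)))) * (C * Real.exp (l * (3 * q + 1 : ℕ))) 
      = Real.exp (-(l * (2 * p + (2 * k + 1)))) * Real.exp (l * (3 * q + 1 : ℕ)) := by field_simp
    rw [this, ← Real.exp_add, ← Real.exp_add, hM]
    push_cast; ring_nf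
  rw [h6]
  exact mul_le_mul_of_nonneg_left h5 (by positivity)

lemma exists_meas [CompactSpace X] [Nonempty X] [MeasurableSpace X] [BorelSpace X] : 
    ∃ c D : ℝ, 0 < c ∧ 0 < D ∧ ∃ μ : Measure X, IsProbabilityMeasure μ ∧ MeasurePreserving (⇑S.phi) μ μ ∧ 
      ∀ (k : ℕ), ∀ x ∈ Gen S R1, ENNReal.ofReal (c * Real.exp (-(l * (2 * k)))) ≤ μ (Rc S R1 k x) ∧ 
        μ (Rc S R1 k x) ≤ ENNReal.ofReal (D * Real.exp (-(l * (2 * k)))) := by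
  classical
  obtain ⟨p, hp⟩ := glue hs
  have hp : GlueP S R1 p := hp
  obtain ⟨μ, h1, h2, h3, h4⟩ := exists_lim S.phi_cont (fun q => (W_fin hs (3 * q + 1)).toFinset) 
    (fun q w => it S q (rp S R1 (3 * q + 1) w)) (fun q => by 
      rw [Set.Finite.toFinset_nonempty]; exact (gen_ne hs).image _)
  have hcard : ∀ m, (W_fin hs m).toFinset.card = N S R1 m := fun m => by
    rw [N, Set.ncard_eq_toFinset_card _ (W_fin hs m)]
  simp only [hcard, ← it_nat, it_add] at h3 h4
  have hR : (0:ℝ) < R1.ncard * R1.ncard := by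
    obtain ⟨x⟩ := ‹Nonempty X›
    obtain ⟨R, hR, _⟩ := hs.cov x
    have : 0 < R1.ncard := (Set.ncard_pos hs.fin).2 ⟨R, hR⟩
    positivity
  refine ⟨C⁻¹ * Real.exp (-(l * (2 * p + 1))), (R1.ncard * R1.ncard) * (C ^ 2 * Real.exp (-l)), 
    by positivity, by positivity, μ, h1, h2, fun k x hx => ⟨?_, ?_⟩⟩
  · apply h3 _ (Rc_closed hs hx)
    filter_upwards [Filter.eventually_ge_atTop (k + p)] with q hq j hj
    have h5 := cnt_lower hs hC hN hp q j k hj hq hx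
    refine le_trans (le_of_eq ?_) (h5.trans ?_)
    · rw [mul_assoc C⁻¹, ← Real.exp_add]; ring_nf
    · refine Nat.cast_le.2 (Finset.card_le_card ?_)
      intro w hw
      rw [Finset.mem_filter] at hw ⊢
      refine ⟨hw.1, fun i i0 i1 => ?_⟩
      have hw1 := (W_fin hs _).mem_toFinset.1 hw.1
      rw [← hw.2 i i0 i1, it_add, add_comm i, add_comm (j:ℤ)]
      exact interior_subset (gen_cd (rp_mem hw1) _).2
  · set B := {v ∈ W S R1 (2 * k + 1) | ¬ (Rc S R1 k (it S k (rp S R1 (2 * k + 1) v)) ∩ Rc S R1 k x).Nonempty} 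
      with hB
    have hBf : B.Finite := (W_fin hs _).subset (sep_subset _ _)
    set V := {v ∈ W S R1 (2 * k + 1) | (Rc S R1 k (it S k (rp S R1 (2 * k + 1) v)) ∩ Rc S R1 k x).Nonempty} with hV
    have hVf : V.Finite := (W_fin hs _).subset (sep_subset _ _)
    have hVc := touch_card hs k hx
    rw [← hV, Set.ncard_eq_toFinset_card _ hVf] at hVc
    set G := (⋃ v ∈ B, Rc S R1 k (it S k (rp S R1 (2 * k + 1) v)))ᶜ with hG
    have hGo : IsOpen G := by
      rw [hG, isOpen_compl_iff]
      exact hBf.isClosed_biUnion (fun v hv => Rc_closed hs (gen_it (rp_mem hv.1) _))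
    have hsub : Rc S R1 k x ⊆ G := by
      intro z hz hz'
      simp only [mem_iUnion] at hz'
      obtain ⟨v, hv, hzv⟩ := hz'
      exact hv.2 ⟨z, hzv, hz⟩
    refine (measure_mono hsub).trans ?_
    apply h4 _ hGo
    filter_upwards [Filter.eventually_ge_atTop k] with q hq j hj
    have hle : ((W_fin hs (3 * q + 1)).toFinset.filter (fun w => it S (j + q) (rp S R1 (3 * q + 1) w) ∈ G)) ⊆ 
       hVf.toFinset.biUnion (fun v => (W_fin hs (3 * q + 1)).toFinset.filter (fun w => ∀ i : ℤ, -k ≤ i → i ≤ k → 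
      cd R1 (it S (q + j + i) (rp S R1 (3 * q + 1) w)) = cd R1 (it S i (it S k (rp S R1 (2 * k + 1) v))))) := by
      intro w hw
      rw [Finset.mem_filter] at hw
      obtain ⟨hw, hwG⟩ := hw
      have hw1 := (W_fin hs _).mem_toFinset.1 hw
      set z := it S (j + q) (rp S R1 (3 * q + 1) w) with hz
      have hzg : z ∈ Gen S R1 := gen_it (rp_mem hw1) _
      have hzg' := gen_it hzg (-(k:ℤ))
      set v := wd S R1 (2 * k + 1) (it S (-(k:ℤ)) z) with hv
      have hvW : v ∈ W S R1 (2 * k + 1) := wd_mem hzg'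
      have hcode : ∀ i : ℤ, -k ≤ i → i ≤ k → cd R1 (it S i z) = cd R1 (it S i (it S k (rp S R1 (2 * k + 1) v))) := by
        intro i i0 i1
        have := rp_wd (m := 2 * k + 1) hzg' (i + k) (by omega) (by push_cast; omega)
        rw [it_add S _ (-(k:ℤ)), add_neg_cancel_right] at this
        rw [it_add S i k, ← this]
      have hvB : v ∉ B := by
        intro hvB
        apply hwG
        simp only [mem_iUnion]
        refine ⟨v, hvB, fun i i0 i1 => ?_⟩
        rw [← hcode i i0 i1]
        exact interior_subset (gen_cd hzg i).2
      have hvV : v ∈ V := by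
        refine ⟨hvW, ?_⟩
        by_contra h
        exact hvB ⟨hvW, h⟩
      rw [Finset.mem_biUnion]
      refine ⟨v, hVf.mem_toFinset.2 hvV, Finset.mem_filter.2 ⟨hw, fun i i0 i1 => ?_⟩⟩
      rw [← hcode i i0 i1, hz, it_add, add_comm i, add_comm (j:ℤ)]
    have hle2 := (Finset.card_le_card hle).trans Finset.card_biUnion_le
    have hle3 : (((W_fin hs (3 * q + 1)).toFinset.filter (fun w => it S (j + q) (rp S R1 (3 * q + 1) w) ∈ G)).card : ℝ) ≤ 
      ∑ v ∈ hVf.toFinset, (((W_fin hs (3 * q + 1)).toFinset.filter (fun w => ∀ i : ℤ, -k ≤ i → i ≤ k → 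
      cd R1 (it S (q + j + i) (rp S R1 (3 * q + 1) w)) = cd R1 (it S i (it S k (rp S R1 (2 * k + 1) v))))).card : ℝ) := by
      exact_mod_cast hle2
    refine le_trans (le_of_eq (by congr!)) (hle3.trans ((Finset.sum_le_card_nsmul _ _ _ (fun v _ => cnt_upper hs hC hN q j k hj hq)).trans ?_))
    rw [nsmul_eq_mul]
    have hVc' : (hVf.toFinset.card : ℝ) ≤ R1.ncard * R1.ncard := by exact_mod_cast hVc
    refine (mul_le_mul_of_nonneg_right hVc' (by positivity)).trans (le_of_eq ?_)
    have : Real.exp (-(l * (2 * k + 1))) = Real.exp (-l) * Real.exp (-(l * (2 * k))) := by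
      rw [← Real.exp_add]; ring_nf
    rw [this]; ring
end
end SB

open Set Metric MeasureTheory Topology
open scoped ENNReal NNReal
namespace SB
variable {X : Type*} [MetricSpace X]

lemma lip_attain {f : X → X} {L : ℝ} (hL : 0 ≤ L) (h : ENNReal.ofReal L = lipConst f) (x y : X) :
    dist (f x) (f y) ≤ L * dist x y := by
  rcases eq_or_ne x y with rfl | hxy
  · simp
  have h0 : edist x y ≠ 0 := by simpa using hxy
  have h1 : edist (f x) (f y) / edist x y ≤ lipConst f := by
    refine le_sInf (fun K hK => ?_)
    rw [ENNReal.div_le_iff h0 (edist_ne_top x y)]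
    exact hK x y
  rw [← h, ENNReal.div_le_iff h0 (edist_ne_top x y), edist_dist, edist_dist, ← ENNReal.ofReal_mul hL] at h1
  exact (ENNReal.ofReal_le_ofReal_iff (by positivity)).1 h1

lemma nontriv (S : SmaleSpace X) 
    (hsc : ENNReal.ofReal S.lam = min (lipConst ⇑S.phi) (lipConst ⇑S.phi.symm)) : Nontrivial X := by
  by_contra hn
  rw [not_nontrivial_iff_subsingleton] at hn
  have h1 : lipConst ⇑S.phi ≤ 0 := sInf_le (by 
    intro x y
    rw [Subsingleton.elim x y]; simp)
  have h2 : ENNReal.ofReal S.lam ≤ 0 := hsc ▸ (min_le_left _ _).trans h1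
  have := ENNReal.ofReal_eq_zero.1 (le_antisymm h2 bot_le)
  linarith [S.one_lt_lam]

lemma mk_setup [CompactSpace X] (S : SmaleSpace X) (ε' ε'' : ℝ)
    (hε' : S.epsOne ε') (hε'' : S.epsTwo ε' ε'')
    (hmix : MixingSystem ⇑S.phi)
    (R1 : Set (Set X)) (hMP : S.IsMarkovPartition ε' R1)
    (hdiam : ∀ R ∈ R1, diam R ≤ ε'' / 2) : Setup S R1 ε'' := by
  obtain ⟨a1, a2, a3⟩ := hε'
  obtain ⟨b1, b2, -⟩ := hε''
  obtain ⟨m1, m2, m3, m4, m5⟩ := hMP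
  have dle : ∀ R ∈ R1, ∀ x ∈ R, ∀ y ∈ R, dist x y ≤ ε'' / 2 := fun R hR x hx y hy => 
    (dist_le_diam_of_mem (isCompact_univ.isBounded.subset (subset_univ _)) hx hy).trans (hdiam R hR)
  refine ⟨b1, by linarith, fun x y h => a3 x y (by linarith), m1, ?_, dle, fun R hR => (m3 R hR).1.2.2,
    fun R hR => (m3 R hR).2.1, fun R hR => (m3 R hR).2.2.subset, ?_, ?_, ?_, ?_, ?_⟩
  · intro x
    have : x ∈ ⋃₀ R1 := m2 ▸ mem_univ x
    exact this
  · intro R hR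
    have h1 := (m3 R hR).1.1
    rw [(m3 R hR).2.2] at h1
    exact closure_nonempty_iff.1 h1
  · intro R hR R' hR' x hx hx'
    by_contra hne
    have : x ∈ interior R ∩ interior R' := ⟨hx, hx'⟩
    rw [m4 R hR R' hR' hne] at this
    exact this
  · intro R hR R' hR' x y hx hx' hy hb
    rw [it_one] at hx' ⊢
    have := (m5 R hR R' hR' x hx hx').2 ⟨y, ⟨⟨by 
      linarith [dle R hR x (interior_subset hx) y hy], hb⟩, hy⟩, rfl⟩
    exact this.2
  · intro R hR R' hR' x y hx hx' hy hb
    rw [it_neg_one] at hx ⊢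
    have := (m5 R hR R' hR' (S.phi.symm x) hx (by simpa using hx')).1 
      (show y ∈ _ from ⟨⟨by 
        rw [Equiv.apply_symm_apply]; linarith [dle R' hR' x (interior_subset hx') y hy], by
        rw [Equiv.apply_symm_apply]; exact hb⟩, hy⟩)
    obtain ⟨z, hz, rfl⟩ := this
    rw [Equiv.symm_apply_apply]; exact hz.2
  · intro U V hU hV hUn hVn
    obtain ⟨N, hN⟩ := hmix U V hU hV hUn hVn
    refine ⟨N, fun n hn => ?_⟩
    obtain ⟨_, ⟨x, hx, rfl⟩, hV⟩ := hN n hn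
    exact ⟨x, hx, by rw [it_nat]; exact hV⟩

lemma seq_eq [CompactSpace X] {S : SmaleSpace X} {R1 : Set (Set X)} {e : ℝ} (hs : Setup S R1 e) {n : ℕ} {R : Set X}
    (hR : R ∈ S.markovSeq R1 (n + 1)) : ∃ x ∈ Gen S R1, R = Rc S R1 n x := by
  obtain ⟨hne, g, hg, rfl⟩ := hR
  obtain ⟨x, hx, hxi⟩ := exists_gen hs isOpen_interior hne
  refine ⟨x, hx, ?_⟩
  have hxR := interior_subset hxi
  simp only [mem_iInter, Finset.mem_Icc, mem_preimage] at hxR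
  ext z
  simp only [mem_iInter, Finset.mem_Icc, mem_preimage, Rc]
  constructor
  · intro h i i0 i1
    rw [cd_eq hs (gen_it hx i) (hg i) (hxR i ⟨i0, i1⟩)]
    exact h i ⟨i0, i1⟩
  · rintro h i ⟨i0, i1⟩
    have := h i i0 i1
    rw [cd_eq hs (gen_it hx i) (hg i) (hxR i ⟨i0, i1⟩)] at this
    exact this

lemma main_num {lam h d c1 e c D : ℝ} (hlam : 1 < lam) (hh : 0 ≤ h) (hc1 : 0 < c1) (he : 0 < e) (hc : 0 < c) (hD : 0 < D)
    (n : ℕ) (h1 : c1 * lam⁻¹ ^ n ≤ d) (h2 : d ≤ e * lam⁻¹ ^ n) :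
    let s := 2 * h / Real.log lam
    let K := e ^ s / c + D / c1 ^ s
    K⁻¹ * d ^ s ≤ c * Real.exp (-(h * (2 * n))) ∧ D * Real.exp (-(h * (2 * n))) ≤ K * d ^ s := by
  intro s K
  have hlog : 0 < Real.log lam := Real.log_pos hlam
  have hs : 0 ≤ s := by positivity
  have hlp : 0 < lam := by linarith
  have hE : (lam⁻¹ ^ n) ^ s = Real.exp (-(h * (2 * n))) := by
    rw [Real.rpow_def_of_pos (by positivity), Real.log_pow, Real.log_inv]
    congr 1
    simp only [s]; field_simp
  have hd : 0 < d := lt_of_lt_of_le (by positivity) h1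
  have k1 : c1 ^ s * Real.exp (-(h * (2 * n))) ≤ d ^ s := by
    rw [← hE, ← Real.mul_rpow hc1.le (by positivity)]
    exact Real.rpow_le_rpow (by positivity) h1 hs
  have k2 : d ^ s ≤ e ^ s * Real.exp (-(h * (2 * n))) := by
    rw [← hE, ← Real.mul_rpow he.le (by positivity)]
    exact Real.rpow_le_rpow hd.le h2 hs
  have e1 : 0 < e ^ s := by positivity
  have e2 : 0 < c1 ^ s := by positivity
  have e3 : 0 < d ^ s := by positivity
  have hK : 0 < K := by positivity
  set E := Real.exp (-(h * (2 * n)))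
  have hEp : 0 < E := Real.exp_pos _
  constructor
  · rw [inv_mul_le_iff₀ hK]
    refine k2.trans ?_
    have : e ^ s * E = e ^ s / c * (c * E) := by field_simp
    rw [this]
    refine mul_le_mul_of_nonneg_right ?_ (by positivity)
    have : 0 < D / c1 ^ s := by positivity
    simp only [K]; linarith
  · have : D * E = D / c1 ^ s * (c1 ^ s * E) := by field_simp
    rw [this]
    refine mul_le_mul ?_ k1 (by positivity) hK.le
    have : 0 < e ^ s / c := by positivity
    simp only [K]; linarith
end SB

/-- For a mixing semi-conformal Smale space with a Markov partition of diameter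
at most `ε''_X / 2`, there are `K > 0` and a `φ`-invariant Borel probability
measure `μ` (Bowen's measure) with
`K⁻¹ diam(R)^{s₀} ≤ μ R ≤ K diam(R)^{s₀}` for every `R ∈ ℛ_n`, where
`s₀ = 2 h(φ) / log λ_X`. -/
theorem semiconformal_bowen_measure_on_rectangles {X : Type*} [MetricSpace X]
    [CompactSpace X] [MeasurableSpace X] [BorelSpace X]
    (S : SmaleSpace X) (ε' ε'' : ℝ)
    (hε' : S.epsOne ε') (hε'' : S.epsTwo ε' ε'')
    (hmix : MixingSystem ⇑S.phi)
    (hsc : ENNReal.ofReal S.lam = min (lipConst ⇑S.phi) (lipConst ⇑S.phi.symm))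
    (R1 : Set (Set X)) (hMP : S.IsMarkovPartition ε' R1)
    (hdiam : ∀ R ∈ R1, diam R ≤ ε'' / 2)
    (h : ℝ) (hent : Dynamics.coverEntropy ⇑S.phi Set.univ = (h : EReal)) :
    ∃ K : ℝ, 0 < K ∧ ∃ μ : Measure X, IsProbabilityMeasure μ ∧
      MeasurePreserving ⇑S.phi μ μ ∧
      ∀ n : ℕ, 1 ≤ n → ∀ R ∈ S.markovSeq R1 n,
        ENNReal.ofReal (K⁻¹ * diam R ^ (2 * h / Real.log S.lam)) ≤ μ R ∧
        μ R ≤ ENNReal.ofReal (K * diam R ^ (2 * h / Real.log S.lam)) := by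
  haveI := SB.nontriv S hsc
  have hs := SB.mk_setup S ε' ε'' hε' hε'' hmix R1 hMP hdiam
  have hlp : 0 ≤ S.lam := by linarith [S.one_lt_lam]
  obtain ⟨l, C, hl, hC, hN⟩ := SB.N_growth hs
  have hlh : h = l := by
    have := SB.entropy_eq hs hl hC hN
    rw [hent] at this
    exact_mod_cast this
  subst hlh
  obtain ⟨c, D, hc, hD, μ, hμ1, hμ2, hμ3⟩ := SB.exists_meas hs hC hN
  have hlow : ∃ c1 > 0, ∀ n : ℕ, ∀ x ∈ SB.Gen S R1, c1 * S.lam⁻¹ ^ n ≤ diam (SB.Rc S R1 n x) := by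
    have key : ∃ c > 0, ∀ n : ℕ, ∀ x ∈ SB.Gen S R1, ∃ a b,
        (∀ i : ℤ, -n ≤ i → i ≤ n → SB.it S i a ∈ SB.cd R1 (SB.it S i x) ∧
          SB.it S i b ∈ SB.cd R1 (SB.it S i x)) ∧ c * S.lam⁻¹ ^ n ≤ dist a b := by
      rcases min_choice (lipConst ⇑S.phi) (lipConst ⇑S.phi.symm) with hm | hm
      · rw [hm] at hsc
        exact SB.diam_lower_u hs (fun x y => SB.lip_attain hlp hsc x y)
      · rw [hm] at hsc
        exact SB.diam_lower_s hs (fun x y => SB.lip_attain hlp hsc x y)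
    obtain ⟨c1, hc1, H⟩ := key
    refine ⟨c1, hc1, fun n x hx => ?_⟩
    obtain ⟨a, b, hab, hd⟩ := H n x hx
    exact hd.trans (dist_le_diam_of_mem (isCompact_univ.isBounded.subset (subset_univ _))
      (fun i i0 i1 => (hab i i0 i1).1) (fun i i0 i1 => (hab i i0 i1).2))
  obtain ⟨c1, hc1, hlow⟩ := hlow
  have hep := hs.e_pos
  refine ⟨ε'' ^ (2 * h / Real.log S.lam) / c + D / c1 ^ (2 * h / Real.log S.lam), by positivity,
    μ, hμ1, hμ2, fun n hn R hR => ?_⟩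
  obtain ⟨n, rfl⟩ : ∃ k, n = k + 1 := ⟨n - 1, by omega⟩
  obtain ⟨x, hx, rfl⟩ := SB.seq_eq hs hR
  have hup : diam (SB.Rc S R1 n x) ≤ ε'' * S.lam⁻¹ ^ n := by
    refine diam_le_of_forall_dist_le (by positivity) (fun a ha b hb => ?_)
    exact SB.diam_upper hs n (fun i i0 i1 => ⟨_, (SB.gen_cd hx i).1, ha i i0 i1, hb i i0 i1⟩)
  obtain ⟨n1, n2⟩ := SB.main_num S.one_lt_lam hl hc1 hep hc hD n (hlow n x hx) hup
  exact ⟨(ENNReal.ofReal_le_ofReal n1).trans (hμ3 n x hx).1,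
    (hμ3 n x hx).2.trans (ENNReal.ofReal_le_ofReal n2)⟩
end

section
/- Let (X,d,φ) be an irreducible self-similar Smale space (i.e. λ_X = Lip(φ) = Lip(φ^{-1})), and let ℛ₁ be a Markov partition of X with diam(R) ≤ ε''_X/2 for every R ∈ ℛ₁, giving rise to the refining sequence (ℛ_n)_{n≥0} of Markov partitions. Then (ℛ_n) satisfies the uniform finite clustering property: sup over x ∈ X and r ∈ (0, diam X) of #{R ∈ ℛ_{n_r} : R ∩ B̄(x,r) ≠ ∅} is finite, where n_r = min{n ∈ ℕ : diam(R) ≤ r for every R ∈ ℛ_n} and B̄(x,r) is the closed ball of radius r around x. -/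
open Set Metric MeasureTheory Topology
open scoped ENNReal NNReal

namespace SmaleSpace

variable {X : Type*} [MetricSpace X] (S : SmaleSpace X)

theorem br_iter (p q : X) (N : ℕ)
    (h : ∀ i ≤ N, dist (S.phi^[i] p) (S.phi^[i] q) ≤ S.eps) :
    ∀ i ≤ N, S.phi^[i] (S.bracket p q) = S.bracket (S.phi^[i] p) (S.phi^[i] q) := by
  intro i
  induction i with
  | zero => intro _; rfl
  | succ k ih =>
    intro hk
    have h1 := h k (by omega)
    have h2 := h (k+1) hk
    rw [Function.iterate_succ_apply'] at h2 ⊢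
    rw [Function.iterate_succ_apply'] at h2
    rw [ih (by omega), S.bracket_phi _ _ h1 h2, Function.iterate_succ_apply',
      Function.iterate_succ_apply']

theorem core (ε' : ℝ) (hε' : 0 < ε') (hle : ε' ≤ S.eps / 2) (P : Set (Set X))
    (hMP : S.IsMarkovPartition ε' P)
    (hd : ∀ R ∈ P, ∀ x ∈ R, ∀ y ∈ R, dist x y ≤ ε')
    (N : ℕ) (h h' : ℕ → Set X) (hP : ∀ i, h i ∈ P) (hP' : ∀ i, h' i ∈ P)
    (h0 : h 0 = h' 0) (hN : h N = h' N) (v v' : X)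
    (hv : ∀ i ≤ N, S.phi^[i] v ∈ interior (h i))
    (hv' : ∀ i ≤ N, S.phi^[i] v' ∈ interior (h' i))
    (hc : ∀ i ≤ N, dist (S.phi^[i] v) (S.phi^[i] v') ≤ S.eps) :
    ∀ i ≤ N, S.phi^[i] (S.bracket v v') ∈ h i ∩ h' i := by
  obtain ⟨hfin, hcov, hrect, hdisj, hmark⟩ := hMP
  have hit := S.br_iter v v' N hc
  have a0 : v ∈ h 0 := interior_subset (hv 0 (by omega))
  have b0 : v' ∈ h 0 := by rw [h0]; exact interior_subset (hv' 0 (by omega))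
  have z0 : S.bracket v v' ∈ h 0 := (hrect _ (hP 0)).1.2.2 _ a0 _ b0
  have hs : ∀ i ≤ N, S.phi^[i] (S.bracket v v') ∈ S.stableIn ε' (S.phi^[i] v) (h i) := by
    intro i
    induction i with
    | zero =>
      intro _
      have e1 := hd _ (hP 0) _ a0 _ z0
      have e2 := hd _ (hP 0) _ a0 _ b0
      refine ⟨⟨?_, ?_⟩, z0⟩
      · simp only [Function.iterate_zero, id]
        linarith
      · simp only [Function.iterate_zero, id]
        exact S.bracket_assoc₁ _ _ _ (by linarith) (by linarith) (by linarith)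
    | succ k ih =>
      intro hk
      have := (hmark _ (hP k) _ (hP (k+1)) (S.phi^[k] v) (hv k (by omega))
        (by have := hv (k+1) hk; rwa [Function.iterate_succ_apply'] at this)).2
      have := this (mem_image_of_mem _ (ih (by omega)))
      rwa [Function.iterate_succ_apply', Function.iterate_succ_apply']
  have hu : ∀ j ≤ N, S.phi^[N - j] (S.bracket v v') ∈
      S.unstableIn ε' (S.phi^[N-j] v') (h' (N-j)) := by
    intro j
    induction j with
    | zero =>
      intro _
      simp only [Nat.sub_zero]
      have zN : S.phi^[N] (S.bracket v v') ∈ h' N := by rw [← hN]; exact (hs N le_rfl).2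
      have bN : S.phi^[N] v' ∈ h' N := interior_subset (hv' N le_rfl)
      have e1 := hd _ (hP' N) _ bN _ zN
      have e2 := hc N le_rfl
      refine ⟨⟨by linarith, ?_⟩, zN⟩
      rw [dist_comm] at e1
      rw [hit N le_rfl] at e1 ⊢
      exact S.bracket_assoc₂ _ _ _ (by linarith) (by linarith) (by linarith)
    | succ k ih =>
      intro hk
      have hi : N - k = (N - (k+1)) + 1 := by omega
      have ih := ih (by omega)
      rw [hi] at ih
      generalize hm : N - (k+1) = m at *
      have := (hmark _ (hP' m) _ (hP' (m+1)) (S.phi^[m] v') (hv' m (by omega))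
        (by have := hv' (m+1) (by omega); rwa [Function.iterate_succ_apply'] at this)).1
      rw [Function.iterate_succ_apply', Function.iterate_succ_apply'] at ih
      obtain ⟨w, hw, hwe⟩ := this ih
      rwa [S.phi.injective hwe] at hw
  intro i hi
  refine ⟨(hs i hi).2, ?_⟩
  have := (hu (N - i) (by omega)).2
  rwa [Nat.sub_sub_self hi] at this

theorem iter_open (U : Set X) (hU : IsOpen U) (i : ℕ) : IsOpen (S.phi^[i] '' U) := by
  have : S.phi^[i] '' U = S.phi.symm^[i] ⁻¹' U := by
    refine congrFun (Set.image_eq_preimage_of_inverse ?_ ?_) U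
    · exact (Function.LeftInverse.iterate S.phi.symm_apply_apply i)
    · exact (Function.LeftInverse.iterate S.phi.apply_symm_apply i)
  rw [this]
  exact hU.preimage (S.phi_symm_cont.iterate i)

theorem unique_word (ε' : ℝ) (hε' : 0 < ε') (hle : ε' ≤ S.eps / 2) (P : Set (Set X))
    (hMP : S.IsMarkovPartition ε' P)
    (hd : ∀ R ∈ P, ∀ x ∈ R, ∀ y ∈ R, dist x y ≤ ε')
    (N : ℕ) (h h' : ℕ → Set X) (hP : ∀ i, h i ∈ P) (hP' : ∀ i, h' i ∈ P)
    (h0 : h 0 = h' 0) (hN : h N = h' N) (y y' : X)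
    (hy : ∀ i ≤ N, S.phi^[i] y ∈ interior (h i))
    (hy' : ∀ i ≤ N, S.phi^[i] y' ∈ interior (h' i))
    (hc : ∀ i ≤ N, ∀ a ∈ h i, ∀ b ∈ h' i, dist a b ≤ S.eps) :
    ∀ i ≤ N, h i = h' i := by
  have hrect := hMP.2.2.1
  have hdisj := hMP.2.2.2.1
  have heps := S.eps_pos
  let V : Set X := ⋂ i ∈ Finset.range (N+1), S.phi^[i] ⁻¹' interior (h i)
  let V' : Set X := ⋂ i ∈ Finset.range (N+1), S.phi^[i] ⁻¹' interior (h' i)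
  have hVo : IsOpen V := isOpen_biInter_finset fun i _ =>
    isOpen_interior.preimage (S.phi_cont.iterate i)
  have hVo' : IsOpen V' := isOpen_biInter_finset fun i _ =>
    isOpen_interior.preimage (S.phi_cont.iterate i)
  have memV : ∀ v, v ∈ V ↔ ∀ i ≤ N, S.phi^[i] v ∈ interior (h i) := by
    intro v; simp [V, Nat.lt_succ_iff]
  have memV' : ∀ v, v ∈ V' ↔ ∀ i ≤ N, S.phi^[i] v ∈ interior (h' i) := by
    intro v; simp [V', Nat.lt_succ_iff]
  have a0 : y ∈ h 0 := interior_subset (hy 0 (by omega))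
  have b0 : y' ∈ h 0 := by rw [h0]; exact interior_subset (hy' 0 (by omega))
  have z0 : S.bracket y y' ∈ h 0 := (hrect _ (hP 0)).1.2.2 _ a0 _ b0
  set z := S.bracket y y' with hz
  have dyy' : dist y y' < S.eps := by linarith [hd _ (hP 0) _ a0 _ b0]
  have dzy : dist z y < S.eps := by linarith [hd _ (hP 0) _ z0 _ a0]
  have dzy' : dist z y' < S.eps := by linarith [hd _ (hP 0) _ z0 _ b0]
  have dy'z : dist y' z < S.eps := by rwa [dist_comm]
  have dy'y : dist y' y < S.eps := by rwa [dist_comm]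
  have ezy : S.bracket z y = y := by
    rw [hz, S.bracket_assoc₂ _ _ _ dyy'.le dzy.le (by simpa using heps.le), S.bracket_self]
  have ey'z : S.bracket y' z = y' := by
    rw [hz, S.bracket_assoc₁ _ _ _ dyy'.le dy'z.le (by simpa using heps.le), S.bracket_self]
  have bc : ∀ a b : X, dist a b < S.eps →
      ContinuousAt (fun p : X × X => S.bracket p.1 p.2) (a, b) := by
    intro a b hab
    apply S.bracket_cont.continuousAt
    have : {p : X × X | dist p.1 p.2 < S.eps} ∈ 𝓝 (a, b) :=
      (isOpen_lt continuous_dist continuous_const).mem_nhds hab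
    exact Filter.mem_of_superset this fun p (hp : dist p.1 p.2 < S.eps) =>
      show dist p.1 p.2 ≤ S.eps from hp.le
  have c1 : Filter.Tendsto (fun w => S.bracket w y) (𝓝 z) (𝓝 y) := by
    have h1 : ContinuousAt (fun w => S.bracket w y) z :=
      ContinuousAt.comp (g := fun p : X × X => S.bracket p.1 p.2) (f := fun w => (w, y))
        (bc z y dzy) (by fun_prop)
    have h2 := h1.tendsto
    rwa [ezy] at h2
  have c2 : Filter.Tendsto (fun w => S.bracket y' w) (𝓝 z) (𝓝 y') := by
    have h1 : ContinuousAt (fun w => S.bracket y' w) z :=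
      ContinuousAt.comp (g := fun p : X × X => S.bracket p.1 p.2) (f := fun w => (y', w))
        (bc y' z dy'z) (by fun_prop)
    have h2 := h1.tendsto
    rwa [ey'z] at h2
  have hid : Filter.Tendsto (fun w : X => w) (𝓝 z) (𝓝 z) := Filter.tendsto_id
  have ev : ∀ᶠ w in 𝓝 z, ∀ i ≤ N, S.phi^[i] w ∈ h i ∩ h' i := by
    filter_upwards [c1.eventually (hVo.mem_nhds ((memV y).2 hy)),
      c2.eventually (hVo'.mem_nhds ((memV' y').2 hy')),
      (hid.dist (tendsto_const_nhds (x := y))).eventually (gt_mem_nhds dzy),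
      (hid.dist (tendsto_const_nhds (x := y'))).eventually (gt_mem_nhds dzy'),
      (c1.dist c2).eventually (gt_mem_nhds dyy'),
      (hid.dist c2).eventually (gt_mem_nhds dzy')] with w w1 w2 w3 w4 w5 w6
    have e : S.bracket (S.bracket w y) (S.bracket y' w) = w := by
      rw [S.bracket_assoc₂ _ _ _ w3.le w5.le w6.le,
        S.bracket_assoc₁ _ _ _ (by rw [dist_comm]; exact w4.le) w6.le (by simpa using heps.le),
        S.bracket_self]
    have w1 := (memV _).1 w1
    have w2 := (memV' _).1 w2
    have := S.core ε' hε' hle P hMP hd N h h' hP hP' h0 hN _ _ w1 w2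
      (fun i hi => hc i hi _ (interior_subset (w1 i hi)) _ (interior_subset (w2 i hi)))
    rwa [e] at this
  obtain ⟨U, hUs, hUo, hzU⟩ := _root_.mem_nhds_iff.1 ev
  intro i hi
  by_contra hne
  have hd0 := hdisj _ (hP i) _ (hP' i) hne
  have hsub : S.phi^[i] '' U ⊆ h i ∩ h' i := by
    rintro _ ⟨w, hw, rfl⟩
    exact hUs hw i hi
  have ho := S.iter_open U hUo i
  have hm : S.phi^[i] z ∈ interior (h i) ∩ interior (h' i) :=
    ⟨interior_maximal (hsub.trans inter_subset_left) ho (mem_image_of_mem _ hzU),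
      interior_maximal (hsub.trans inter_subset_right) ho (mem_image_of_mem _ hzU)⟩
  rw [hd0] at hm
  exact hm

theorem contr (P : Set (Set X)) (δ : ℝ) (hδ : δ < S.eps)
    (hbr : ∀ R ∈ P, ∀ x ∈ R, ∀ y ∈ R, S.bracket x y ∈ R)
    (hd : ∀ R ∈ P, ∀ x ∈ R, ∀ y ∈ R, dist x y ≤ δ)
    (N : ℕ) (h : ℕ → Set X) (hP : ∀ i, h i ∈ P) (p q : X)
    (hp : ∀ i ≤ N, S.phi^[i] p ∈ h i)
    (hq : ∀ i ≤ N, S.phi^[i] q ∈ h i) (i : ℕ) (hi : i ≤ N) :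
    dist (S.phi^[i] p) (S.phi^[i] (S.bracket p q)) ≤ S.lam⁻¹ ^ i * δ ∧
    dist (S.phi^[N-i] q) (S.phi^[N-i] (S.bracket p q)) ≤ S.lam⁻¹ ^ i * δ := by
  have heps := S.eps_pos
  have hlam : 0 ≤ S.lam⁻¹ := inv_nonneg.2 (by linarith [S.one_lt_lam])
  have hit := S.br_iter p q N
    (fun i hi => (hd _ (hP i) _ (hp i hi) _ (hq i hi)).trans hδ.le)
  have hzm : ∀ i ≤ N, S.phi^[i] (S.bracket p q) ∈ h i := by
    intro i hi
    rw [hit i hi]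
    exact hbr _ (hP i) _ (hp i hi) _ (hq i hi)
  constructor
  · induction i with
    | zero => simpa using hd _ (hP 0) _ (hp 0 hi) _ (hzm 0 hi)
    | succ k ih =>
      have hk : k ≤ N := by omega
      have ih := ih hk
      have d1 := hd _ (hP k) _ (hp k hk) _ (hzm k hk)
      have d2 := hd _ (hP k) _ (hp k hk) _ (hq k hk)
      have hb : S.bracket (S.phi^[k] p) (S.phi^[k] (S.bracket p q))
          = S.phi^[k] (S.bracket p q) := by
        rw [hit k hk] at d1 ⊢
        exact S.bracket_assoc₁ _ _ _ (by linarith) (by linarith) (by linarith)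
      have := S.contract_s (S.phi^[k] p) S.eps heps le_rfl (S.phi^[k] p)
        (S.phi^[k] (S.bracket p q)) (by simpa using heps) (S.bracket_self _)
        (by linarith) hb
      rw [Function.iterate_succ_apply', Function.iterate_succ_apply', pow_succ', mul_assoc]
      exact this.trans (by gcongr)
  · induction i with
    | zero => simpa using hd _ (hP N) _ (hq N le_rfl) _ (hzm N le_rfl)
    | succ k ih =>
      have ih := ih (by omega)
      have hi' : N - k = (N - (k+1)) + 1 := by omega
      have hk : N - k ≤ N := by omega
      have d1 := hd _ (hP _) _ (hq _ hk) _ (hzm _ hk)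
      have d2 := hd _ (hP _) _ (hp _ hk) _ (hq _ hk)
      have hb : S.bracket (S.phi^[N-k] (S.bracket p q)) (S.phi^[N-k] q)
          = S.phi^[N-k] (S.bracket p q) := by
        rw [dist_comm] at d1
        rw [hit _ hk] at d1 ⊢
        exact S.bracket_assoc₂ _ _ _ (by linarith) (by linarith) (by linarith)
      have := S.contract_u (S.phi^[N-k] q) S.eps heps le_rfl (S.phi^[N-k] q)
        (S.phi^[N-k] (S.bracket p q)) (by simpa using heps) (S.bracket_self _)
        (by linarith) hb
      have e : ∀ w, S.phi.symm (S.phi^[N-k] w) = S.phi^[N-(k+1)] w := by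
        intro w
        rw [hi', Function.iterate_succ_apply', Equiv.symm_apply_apply]
      rw [e, e] at this
      rw [pow_succ', mul_assoc]
      exact this.trans (by gcongr)

theorem lip_of (f : X → X) (c : ℝ) (hc : 0 ≤ c) (h : ENNReal.ofReal c = lipConst f) (x y : X) :
    dist (f x) (f y) ≤ c * dist x y := by
  have key : edist (f x) (f y) ≤ ENNReal.ofReal c * edist x y := by
    rw [h]
    by_cases hxy : x = y
    · simp [hxy]
    have h0 : edist x y ≠ 0 := by simpa using hxy
    rw [← ENNReal.div_le_iff h0 (edist_ne_top x y)]
    apply le_sInf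
    intro K hK
    rw [ENNReal.div_le_iff h0 (edist_ne_top x y)]
    exact hK x y
  rw [edist_dist, edist_dist, ← ENNReal.ofReal_mul hc] at key
  exact (ENNReal.ofReal_le_ofReal_iff (by positivity)).1 key

theorem lip_iter (f : X → X) (c : ℝ) (hc : 0 ≤ c)
    (h : ∀ x y, dist (f x) (f y) ≤ c * dist x y) (n : ℕ) (x y : X) :
    dist (f^[n] x) (f^[n] y) ≤ c ^ n * dist x y := by
  induction n with
  | zero => simp
  | succ k ih =>
    rw [Function.iterate_succ_apply', Function.iterate_succ_apply', pow_succ', mul_assoc]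
    exact (h _ _).trans (by gcongr)

theorem lip_zpow (h1 : ∀ x y, dist (S.phi x) (S.phi y) ≤ S.lam * dist x y)
    (h2 : ∀ x y, dist (S.phi.symm x) (S.phi.symm y) ≤ S.lam * dist x y) (i : ℤ) (m : ℕ)
    (hi : |i| ≤ m) (x y : X) :
    dist ((S.phi ^ i) x) ((S.phi ^ i) y) ≤ S.lam ^ m * dist x y := by
  have hl := S.one_lt_lam
  obtain ⟨n, rfl | rfl⟩ := i.eq_nat_or_neg
  · have hn : n ≤ m := by simpa using hi
    rw [zpow_natCast, Equiv.Perm.coe_pow]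
    refine (lip_iter _ S.lam (by linarith) h1 n x y).trans ?_
    gcongr
    exact hl.le
  · have hn : n ≤ m := by simpa using hi
    rw [zpow_neg, zpow_natCast, ← inv_pow, Equiv.Perm.coe_pow]
    refine (lip_iter _ S.lam (by linarith) h2 n x y).trans ?_
    gcongr
    exact hl.le

theorem shift (m : ℕ) (x : X) (i : ℕ) :
    S.phi^[i] ((S.phi ^ (-(m:ℤ))) x) = (S.phi ^ ((i:ℤ) - m)) x := by
  rw [← Equiv.Perm.coe_pow, ← zpow_natCast, ← Equiv.Perm.mul_apply, ← zpow_add]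
  rfl

theorem cont_zpow (i : ℤ) : Continuous ⇑(S.phi ^ i) := by
  obtain ⟨n, rfl | rfl⟩ := i.eq_nat_or_neg
  · rw [zpow_natCast, Equiv.Perm.coe_pow]
    exact S.phi_cont.iterate n
  · rw [zpow_neg, zpow_natCast, ← inv_pow, Equiv.Perm.coe_pow]
    exact Continuous.iterate S.phi_symm_cont n

theorem int_zpow (i : ℤ) (A B : Set X) (h : A ⊆ (⇑(S.phi ^ i)) ⁻¹' B) (y : X)
    (hy : y ∈ interior A) : (S.phi ^ i) y ∈ interior B := by
  rw [mem_interior]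
  refine ⟨(⇑(S.phi ^ (-i))) ⁻¹' interior A, ?_, isOpen_interior.preimage (S.cont_zpow _), ?_⟩
  · intro w hw
    have := h (interior_subset hw)
    simpa [zpow_neg] using this
  · simpa [zpow_neg] using hy

end SmaleSpace

open Set Metric Topology
open scoped ENNReal

/-- Any refining sequence of Markov partitions of an irreducible self-similar
Smale space satisfies the uniform finite clustering property: the number of
rectangles of `ℛ_{n_r}` meeting a closed ball of radius `r` is bounded
independently of the centre and of `r ∈ (0, diam X)`, where
`n_r = min {n : diam R ≤ r for all R ∈ ℛ_n}`. -/
theorem selfSimilar_markovSeq_UFCP {X : Type*} [MetricSpace X]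
    [CompactSpace X] (S : SmaleSpace X) (ε' ε'' : ℝ)
    (hε' : S.epsOne ε') (hε'' : S.epsTwo ε' ε'')
    (hirr : IrreducibleSystem ⇑S.phi)
    (hss : ENNReal.ofReal S.lam = lipConst ⇑S.phi ∧
      ENNReal.ofReal S.lam = lipConst ⇑S.phi.symm)
    (R1 : Set (Set X)) (hMP : S.IsMarkovPartition ε' R1)
    (hdiam : ∀ R ∈ R1, diam R ≤ ε'' / 2) :
    ∃ B : ℕ, ∀ (x : X) (r : ℝ), 0 < r → r < diam (Set.univ : Set X) →
      (nbr (S.markovSeq R1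
          (sInf {n : ℕ | ∀ R ∈ S.markovSeq R1 n, diam R ≤ r}))
        (closedBall x r)).ncard ≤ B := by
  have heps := S.eps_pos
  have hl := S.one_lt_lam
  have hl0 : 0 < S.lam := by linarith
  obtain ⟨e1, e2, -⟩ := hε'
  obtain ⟨f1, f2, -⟩ := hε''
  have L1 := SmaleSpace.lip_of _ _ hl0.le hss.1
  have L2 := SmaleSpace.lip_of _ _ hl0.le hss.2
  have hd : ∀ R ∈ R1, ∀ x ∈ R, ∀ y ∈ R, dist x y ≤ ε'' / 2 := fun R hR x hx y hy =>
    (dist_le_diam_of_mem (isBounded_of_compactSpace) hx hy).trans (hdiam R hR)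
  have hd' : ∀ R ∈ R1, ∀ x ∈ R, ∀ y ∈ R, dist x y ≤ ε' := fun R hR x hx y hy => by
    linarith [hd R hR x hx y hy]
  have hfin := hMP.1
  have hrect := hMP.2.2.1
  have hbr : ∀ R ∈ R1, ∀ x ∈ R, ∀ y ∈ R, S.bracket x y ∈ R := fun R hR => (hrect R hR).1.2.2
  -- diameters
  have hD : ∀ (m : ℕ), ∀ R ∈ S.markovSeq R1 (m+1), diam R ≤ S.lam⁻¹ ^ m * ε'' := by
    rintro m R ⟨-, g, hg, rfl⟩
    apply diam_le_of_forall_dist_le (by positivity)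
    intro p hp q hq
    simp only [mem_iInter, Finset.mem_Icc, mem_preimage] at hp hq
    have hc := S.contr R1 (ε''/2) (by linarith) hbr hd (2*m) (fun i => g (i - m))
      (fun i => hg _) ((S.phi ^ (-(m:ℤ))) p) ((S.phi ^ (-(m:ℤ))) q)
      (fun i hi => by rw [S.shift]; exact hp _ (by omega))
      (fun i hi => by rw [S.shift]; exact hq _ (by omega)) m (by omega)
    rw [show 2 * m - m = m by omega, S.shift, S.shift] at hc
    simp only [sub_self, zpow_zero, Equiv.Perm.coe_one, id] at hc
    have := dist_triangle_right p q
      (S.phi^[m] (S.bracket ((S.phi ^ (-(m:ℤ))) p) ((S.phi ^ (-(m:ℤ))) q)))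
    linarith [hc.1, hc.2]
  haveI : Finite R1 := hfin
  refine ⟨Nat.card (Bool × Bool → R1) + 1, ?_⟩
  intro x r hr _
  generalize hn : sInf {n : ℕ | ∀ R ∈ S.markovSeq R1 n, diam R ≤ r} = n
  rcases n with _ | M
  · have : (nbr (S.markovSeq R1 0) (closedBall x r)).ncard ≤ ({Set.univ} : Set (Set X)).ncard :=
      Set.ncard_le_ncard (fun R hR => hR.1) (Set.finite_singleton _)
    rw [Set.ncard_singleton] at this
    omega
  have hM : ∀ m : ℕ, M = m + 1 → S.lam ^ m * r ≤ ε'' := by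
    rintro m rfl
    have : (m+1) ∉ {n : ℕ | ∀ R ∈ S.markovSeq R1 n, diam R ≤ r} :=
      Nat.notMem_of_lt_sInf (by omega)
    simp only [mem_setOf_eq, not_forall, not_le] at this
    obtain ⟨R, hR, hlt⟩ := this
    have h3 := hD m R hR
    have h4 : r ≤ S.lam⁻¹ ^ m * ε'' := by linarith
    calc S.lam ^ m * r ≤ S.lam ^ m * (S.lam⁻¹ ^ m * ε'') := by gcongr
      _ = ε'' := by rw [← mul_assoc, ← mul_pow, mul_inv_cancel₀ hl0.ne', one_pow, one_mul]
  have hex : ∀ R : nbr (S.markovSeq R1 (M+1)) (closedBall x r), ∃ g : ℤ → Set X,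
      (∀ i : ℤ, g i ∈ R1) ∧
      R.1 = ⋂ i ∈ Finset.Icc (-(M : ℤ)) (M : ℤ), (⇑(S.phi ^ i)) ⁻¹' (g i) :=
    fun R => R.2.1.2
  choose g hg hgR using hex
  let idx : Bool × Bool → ℤ := fun b =>
    (if b.1 then 1 else -1) * ((M : ℤ) - (if b.2 then 1 else 0))
  let code : nbr (S.markovSeq R1 (M+1)) (closedBall x r) → (Bool × Bool → R1) :=
    fun R b => ⟨g R (idx b), hg R _⟩
  have hinj : Function.Injective code := by
    intro R R' hRR
    have hco : ∀ b, g R (idx b) = g R' (idx b) := fun b =>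
      congrArg Subtype.val (congrFun hRR b)
    have c1 : g R M = g R' M := by simpa [idx] using hco (true, false)
    have c2 : g R (-M) = g R' (-M) := by simpa [idx] using hco (false, false)
    have c3 : g R (M-1) = g R' (M-1) := by simpa [idx] using hco (true, true)
    have c4 : g R (-(M-1)) = g R' (-(M-1)) := by
      have := hco (false, true)
      simp only [idx, if_true, Bool.false_eq_true, if_false, neg_one_mul] at this
      exact this
    have hall : ∀ i ∈ Finset.Icc (-(M : ℤ)) (M : ℤ), g R i = g R' i := by
      intro i hi
      rw [Finset.mem_Icc] at hi
      by_cases i1 : i = M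
      · rw [i1, c1]
      by_cases i2 : i = -M
      · rw [i2, c2]
      obtain ⟨m, rfl⟩ : ∃ m, M = m + 1 := ⟨M - 1, by omega⟩
      have hmr := hM m rfl
      push_cast at c3 c4 hi i1 i2
      rw [add_sub_cancel_right] at c3 c4
      have memg : ∀ (R : nbr (S.markovSeq R1 (m+1+1)) (closedBall x r)) (i : ℤ), |i| ≤ m →
          R.1 ⊆ (⇑(S.phi ^ i)) ⁻¹' (g R i) := by
        intro R i hi
        have hi := abs_le.1 hi
        conv_lhs => rw [hgR R]
        exact biInter_subset_of_mem (by
          rw [SetLike.mem_coe, Finset.mem_Icc]; push_cast; omega)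
      have near : ∀ (R : nbr (S.markovSeq R1 (m+1+1)) (closedBall x r)) (i : ℤ), |i| ≤ m →
          ∀ a ∈ g R i, dist a ((S.phi ^ i) x) ≤ ε''/2 + ε'' := by
        intro R i hi a ha
        obtain ⟨w, hw, hwx⟩ := R.2.2
        have h1 := hd _ (hg R i) _ ha _ (memg R i hi hw)
        have h2 := S.lip_zpow L1 L2 i m hi w x
        have h3 : S.lam ^ m * dist w x ≤ S.lam ^ m * r := by
          gcongr; exact hwx
        have h4 := dist_triangle a ((S.phi ^ i) w) ((S.phi ^ i) x)
        linarith
      obtain ⟨y, hy⟩ := R.2.1.1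
      obtain ⟨y', hy'⟩ := R'.2.1.1
      have hu := S.unique_word ε' e1 e2 R1 hMP hd' (2*m) (fun j => g R (j - m))
        (fun j => g R' (j - m)) (fun j => hg R _) (fun j => hg R' _)
        (by simpa using c4)
        (by
          have : ((2 * m : ℕ) : ℤ) - m = m := by push_cast; ring
          simp only [this]; exact c3)
        ((S.phi ^ (-(m:ℤ))) y) ((S.phi ^ (-(m:ℤ))) y')
        (fun j hj => by
          rw [S.shift]
          exact S.int_zpow _ _ _ (memg R _ (by rw [abs_le]; omega)) y hy)
        (fun j hj => by
          rw [S.shift]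
          exact S.int_zpow _ _ _ (memg R' _ (by rw [abs_le]; omega)) y' hy')
        (fun j hj a ha b hb => by
          have hj' : |(j:ℤ) - m| ≤ m := by rw [abs_le]; omega
          have h1 := near R _ hj' a ha
          have h2 := near R' _ hj' b hb
          have h3 := dist_triangle_right a b ((S.phi ^ ((j:ℤ) - m)) x)
          linarith)
        (i + m).toNat (by omega)
      have : (((i + m).toNat : ℕ) : ℤ) - m = i := by omega
      simpa only [this] using hu
    apply Subtype.ext
    rw [hgR R, hgR R']
    exact iInter₂_congr fun i hi => by rw [hall i hi]
  have := Nat.card_le_card_of_injective code hinj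
  rw [Nat.card_coe_set_eq] at this
  omega
end
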